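/- arXiv:1601.06543 — 3 statements merged into one kernel-verified Lean document; each statement's English description precedes it below -/
import Mathlib

section
/- Let μ be a finite positive Radon measure on ℝ^d such that every Lipschitz function f : ℝ^d → ℝ is differentiable at μ-almost every point. Then μ is absolutely continuous with respect to Lebesgue measure, μ ≪ ℒ^d. -/
open MeasureTheory

section Walk

variable {G ι : Type*} [AddCommGroup G] [Fintype ι]

/-- The averaging operator of the random walk that stays put or moves by one of the vectors `e i`,
each with the same probability. -/
noncomputable def walkAvg (e : ι → G) : (G → ℝ) →ₗ[ℝ] (G → ℝ) where
  toFun f x := (f x + ∑ i, f (x + e i)) / (Fintype.card ι + 1)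
  map_add' f g := by
    ext x; simp only [Pi.add_apply, Finset.sum_add_distrib]; ring
  map_smul' c f := by
    ext x; simp only [Pi.smul_apply, smul_eq_mul, RingHom.id_apply, ← Finset.mul_sum]; ring

/-- The adjoint of `walkAvg`. -/
noncomputable def walkAdj (e : ι → G) (f : G → ℝ) (x : G) : ℝ :=
  (f x + ∑ i, f (x - e i)) / (Fintype.card ι + 1)

/-- The forward difference in the direction `v`. -/
def fwdDif (v : G) : (G → ℝ) →ₗ[ℝ] (G → ℝ) where
  toFun f x := f (x + v) - f x
  map_add' f g := by ext x; simp only [Pi.add_apply]; ring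
  map_smul' c f := by ext x; simp only [Pi.smul_apply, smul_eq_mul, RingHom.id_apply]; ring

lemma walkAvg_apply (e : ι → G) (f : G → ℝ) (x : G) :
    walkAvg e f x = (f x + ∑ i, f (x + e i)) / (Fintype.card ι + 1) := rfl

lemma fwdDif_apply (v : G) (f : G → ℝ) (x : G) : fwdDif v f x = f (x + v) - f x := rfl

lemma sum_mul_walkAvg [Fintype G] (e : ι → G) (p f : G → ℝ) :
    ∑ x, p x * walkAvg e f x = ∑ x, walkAdj e p x * f x := by
  have h (i : ι) : ∑ x, p x * f (x + e i) = ∑ x, p (x - e i) * f x :=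
    Fintype.sum_equiv (Equiv.addRight (e i)) _ _ (by simp)
  simp only [walkAvg_apply, walkAdj, mul_div_assoc', div_mul_eq_mul_div, ← Finset.sum_div, mul_add,
    add_mul, Finset.sum_add_distrib, Finset.mul_sum, Finset.sum_mul]
  rw [Finset.sum_comm, Finset.sum_comm (f := fun x i => p (x - e i) * f x)]
  simp only [h]

lemma walkAvg_fwdDif (e : ι → G) (v : G) (f : G → ℝ) :
    walkAvg e (fwdDif v f) = fwdDif v (walkAvg e f) := by
  ext x
  simp only [walkAvg_apply, fwdDif_apply, Finset.sum_sub_distrib, add_right_comm x v]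
  ring

lemma walkAvg_pow_fwdDif (e : ι → G) (v : G) (f : G → ℝ) (n : ℕ) :
    (walkAvg e ^ n) (fwdDif v f) = fwdDif v ((walkAvg e ^ n) f) := by
  induction n with
  | zero => rfl
  | succ n ih => rw [pow_succ', Module.End.mul_apply, ih, walkAvg_fwdDif]; rfl

lemma walkAvg_pow_succ (e : ι → G) (f : G → ℝ) (n : ℕ) :
    (walkAvg e ^ (n + 1)) f = walkAvg e ((walkAvg e ^ n) f) := by
  rw [pow_succ']; rfl

lemma walkAvg_nonneg (e : ι → G) {f : G → ℝ} (hf : 0 ≤ f) : 0 ≤ walkAvg e f := fun x =>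
  div_nonneg (add_nonneg (hf x) (Finset.sum_nonneg fun _ _ => hf _)) (by positivity)

lemma walkAvg_pow_nonneg (e : ι → G) {f : G → ℝ} (hf : 0 ≤ f) (n : ℕ) :
    0 ≤ (walkAvg e ^ n) f := by
  induction n with
  | zero => exact hf
  | succ n ih => rw [walkAvg_pow_succ]; exact walkAvg_nonneg e ih

lemma walkAvg_pow_mono (e : ι → G) {f g : G → ℝ} (h : f ≤ g) (n : ℕ) :
    (walkAvg e ^ n) f ≤ (walkAvg e ^ n) g := by
  have := walkAvg_pow_nonneg e (sub_nonneg.2 h) n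
  rwa [map_sub, sub_nonneg] at this

lemma abs_walkAvg_pow_le (e : ι → G) (f : G → ℝ) (n : ℕ) (x : G) :
    |(walkAvg e ^ n) f x| ≤ (walkAvg e ^ n) |f| x := by
  have h1 := walkAvg_pow_mono e (le_abs_self f) n x
  have h2 := walkAvg_pow_mono e (neg_le_abs f) n x
  rw [map_neg] at h2
  exact abs_le'.2 ⟨h1, h2⟩

lemma walkAdj_nonneg (e : ι → G) {f : G → ℝ} (hf : 0 ≤ f) : 0 ≤ walkAdj e f := fun x =>
  div_nonneg (add_nonneg (hf x) (Finset.sum_nonneg fun _ _ => hf _)) (by positivity)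

lemma walkAdj_le_one (e : ι → G) {f : G → ℝ} (hf : ∀ x, f x ≤ 1) (x : G) : walkAdj e f x ≤ 1 := by
  rw [walkAdj, div_le_one (by positivity)]
  have : ∑ i, f (x - e i) ≤ ∑ _i : ι, (1 : ℝ) := Finset.sum_le_sum fun _ _ => hf _
  simp at this
  linarith [hf x]

lemma sum_walkAvg [Fintype G] (e : ι → G) (f : G → ℝ) : ∑ x, walkAvg e f x = ∑ x, f x := by
  have := sum_mul_walkAvg e 1 f
  have h1 : ∀ x, walkAdj e 1 x = 1 := fun x => by
    simp only [walkAdj, Pi.one_apply, Finset.sum_const, Finset.card_univ, nsmul_eq_mul, mul_one]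
    rw [div_eq_one_iff_eq (by positivity)]; ring
  simpa [h1] using this

lemma sum_walkAvg_pow [Fintype G] (e : ι → G) (f : G → ℝ) (n : ℕ) :
    ∑ x, (walkAvg e ^ n) f x = ∑ x, f x := by
  induction n with
  | zero => rfl
  | succ n ih => rw [walkAvg_pow_succ, sum_walkAvg, ih]

lemma le_walkAvg (e : ι → G) {f : G → ℝ} (hf : 0 ≤ f) (x : G) :
    f x ≤ (Fintype.card ι + 1) * walkAvg e f x := by
  rw [walkAvg_apply, mul_div_cancel₀ _ (by positivity)]
  linarith [Finset.sum_nonneg fun (i : ι) (_ : i ∈ Finset.univ) => hf (x + e i)]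

lemma le_walkAvg' (e : ι → G) {f : G → ℝ} (hf : 0 ≤ f) (x : G) (i : ι) :
    f (x + e i) ≤ (Fintype.card ι + 1) * walkAvg e f x := by
  rw [walkAvg_apply, mul_div_cancel₀ _ (by positivity)]
  have h1 : f (x + e i) ≤ ∑ i, f (x + e i) :=
    Finset.single_le_sum (f := fun i => f (x + e i)) (fun i _ => hf (x + e i)) (Finset.mem_univ i)
  have h2 : 0 ≤ f x := hf x
  linarith

/-- The variance of one step of the walk, in terms of forward differences. -/
lemma walkAvg_sq_sub (e : ι → G) (f : G → ℝ) (x : G) :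
    walkAvg e (f ^ 2) x - (walkAvg e f x) ^ 2 =
      (∑ i, (fwdDif (e i) f x) ^ 2) / (Fintype.card ι + 1)
        - ((∑ i, fwdDif (e i) f x) / (Fintype.card ι + 1)) ^ 2 := by
  have hq : (Fintype.card ι + 1 : ℝ) ≠ 0 := by positivity
  simp only [walkAvg_apply, fwdDif_apply, Pi.pow_apply, sub_sq, Finset.sum_add_distrib,
    Finset.sum_sub_distrib, Finset.sum_const, Finset.card_univ, nsmul_eq_mul,
    ← Finset.sum_mul, ← Finset.mul_sum]
  field_simp
  ring

lemma walkAvg_sq_sub_le (e : ι → G) (f : G → ℝ) (x : G) :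
    walkAvg e (f ^ 2) x - (walkAvg e f x) ^ 2 ≤
      (∑ i, (fwdDif (e i) f x) ^ 2) / (Fintype.card ι + 1) := by
  rw [walkAvg_sq_sub]
  linarith [sq_nonneg ((∑ i, fwdDif (e i) f x) / (Fintype.card ι + 1 : ℝ))]

lemma sum_fwdDif_sq_le (e : ι → G) (f : G → ℝ) (x : G) :
    ∑ i, (fwdDif (e i) f x) ^ 2 ≤
      (Fintype.card ι + 1) ^ 2 * (walkAvg e (f ^ 2) x - (walkAvg e f x) ^ 2) := by
  rw [walkAvg_sq_sub]
  have h := sq_sum_le_card_mul_sum_sq (s := (Finset.univ : Finset ι))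
    (f := fun i => fwdDif (e i) f x)
  rw [Finset.card_univ] at h
  have hq : (Fintype.card ι + 1 : ℝ) ≠ 0 := by positivity
  rw [div_pow, mul_sub, mul_div_cancel₀ _ (by positivity), sq (Fintype.card ι + 1 : ℝ), mul_assoc,
    mul_div_cancel₀ _ hq]
  linarith

/-- The walk killed when it leaves the level set `{a j ≤ T}`: densities of the surviving
part (`P`) and of the part killed at time `j` (`Q`); time runs downwards from `n`. -/
lemma exists_killed_walk (e : ι → G) (a : ℕ → G → ℝ) (T : ℝ) (n : ℕ)
    (ha : ∀ j, 0 ≤ a j) (hstep : ∀ j, walkAvg e (a j) = a (j + 1)) (hT : ∀ x, a n x ≤ T) :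
    ∃ P Q : ℕ → G → ℝ, P n = 1 ∧ (∀ j ≤ n, ∀ x, 0 ≤ P j x ∧ P j x ≤ 1 ∧ (P j x ≠ 0 → a j x ≤ T)) ∧
      (∀ j < n, ∀ x, 0 ≤ Q j x ∧
        (Q j x ≠ 0 → T ≤ a j x ∧ a j x ≤ (Fintype.card ι + 1) * T) ∧
        P j x + Q j x = walkAdj e (P (j + 1)) x) := by
  classical
  let S : ℕ → G → ℝ := fun k => Nat.rec 1
    (fun k p x => if a (n - (k + 1)) x ≤ T then walkAdj e p x else 0) k
  have hS (k : ℕ) : S (k + 1) = fun x => if a (n - (k + 1)) x ≤ T then walkAdj e (S k) x else 0 :=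
    rfl
  have hS0 (k : ℕ) : ∀ x, 0 ≤ S k x ∧ S k x ≤ 1 ∧ (S k x ≠ 0 → a (n - k) x ≤ T) := by
    induction k with
    | zero => exact fun x => ⟨zero_le_one, le_rfl, fun _ => hT x⟩
    | succ k ih =>
      intro x
      rw [hS]
      have h1 := walkAdj_nonneg e (f := S k) (fun x => (ih x).1) x
      have h2 := walkAdj_le_one e (f := S k) (fun x => (ih x).2.1) x
      dsimp only
      split_ifs with h
      · exact ⟨h1, h2, fun _ => h⟩
      · simp
  refine ⟨fun j => S (n - j),
    fun j x => if a j x ≤ T then 0 else walkAdj e (S (n - (j + 1))) x, ?_, ?_, ?_⟩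
  · simp only [Nat.sub_self]; rfl
  · intro j hj x
    have := hS0 (n - j) x
    rwa [Nat.sub_sub_self hj] at this
  · intro j hj x
    have hk : n - j = (n - (j + 1)) + 1 := by omega
    have hk' : n - (n - (j + 1) + 1) = j := by omega
    have hn := walkAdj_nonneg e (f := S (n - (j + 1))) (fun x => (hS0 _ x).1) x
    beta_reduce
    rw [hk, hS, hk']
    by_cases h : a j x ≤ T
    · simp [h]
    · simp only [if_neg h]
      refine ⟨hn, fun h0 => ⟨(not_le.1 h).le, ?_⟩, zero_add _⟩
      have key (y : G) (hy : S (n - (j + 1)) y ≠ 0)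
          (hxy : a j x ≤ (Fintype.card ι + 1) * a (j + 1) y) :
          a j x ≤ (Fintype.card ι + 1) * T := by
        have h3 := (hS0 _ y).2.2 hy
        rw [Nat.sub_sub_self (by omega)] at h3
        exact hxy.trans (by gcongr)
      rcases eq_or_ne (S (n - (j + 1)) x) 0 with hx | hx
      · obtain ⟨i, hi⟩ : ∃ i, S (n - (j + 1)) (x - e i) ≠ 0 := by
          by_contra! hc
          exact h0 (by simp [walkAdj, hx, hc])
        refine key _ hi ?_
        have := le_walkAvg' e (ha j) (x - e i) i
        rwa [hstep, sub_add_cancel] at this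
      · refine key _ hx ?_
        have := le_walkAvg e (ha j) x
        rwa [hstep] at this

lemma sum_killed_walk [Fintype G] (e : ι → G) (n : ℕ) {P Q : ℕ → G → ℝ}
    (h : ∀ j < n, ∀ x, P j x + Q j x = walkAdj e (P (j + 1)) x) (g : ℕ → G → ℝ) :
    ∑ j ∈ Finset.range n, ∑ x, P (j + 1) x * (walkAvg e (g j) x - g (j + 1) x) =
      ∑ x, P 0 x * g 0 x + ∑ j ∈ Finset.range n, ∑ x, Q j x * g j x - ∑ x, P n x * g n x := by
  have h1 : ∀ j ∈ Finset.range n, ∑ x, P (j + 1) x * (walkAvg e (g j) x - g (j + 1) x) =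
      ∑ x, Q j x * g j x - (∑ x, P (j + 1) x * g (j + 1) x - ∑ x, P j x * g j x) := by
    intro j hj
    simp only [mul_sub, Finset.sum_sub_distrib, sum_mul_walkAvg,
      ← h j (Finset.mem_range.1 hj), add_mul, Finset.sum_add_distrib]
    ring
  rw [Finset.sum_congr rfl h1, Finset.sum_sub_distrib,
    Finset.sum_range_sub (fun j => ∑ x, P j x * g j x)]
  ring

end Walk

section Core

variable {G ι : Type*} [AddCommGroup G] [Fintype ι]

lemma sum_le_sqrt_mul {κ : Type*} (s : Finset κ) (p f : κ → ℝ) (hp : ∀ i ∈ s, 0 ≤ p i) :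
    ∑ i ∈ s, p i * f i ≤ √((∑ i ∈ s, p i) * ∑ i ∈ s, p i * f i ^ 2) := by
  apply Real.le_sqrt_of_sq_le
  have := Finset.sum_mul_sq_le_sq_mul_sq s (fun i => √(p i)) (fun i => √(p i) * f i)
  have e1 : ∀ i ∈ s, √(p i) * (√(p i) * f i) = p i * f i := fun i hi => by
    rw [← mul_assoc, Real.mul_self_sqrt (hp i hi)]
  have e2 : ∀ i ∈ s, √(p i) ^ 2 = p i := fun i hi => Real.sq_sqrt (hp i hi)
  have e3 : ∀ i ∈ s, (√(p i) * f i) ^ 2 = p i * f i ^ 2 := fun i hi => by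
    rw [mul_pow, Real.sq_sqrt (hp i hi)]
  rwa [Finset.sum_congr rfl e1, Finset.sum_congr rfl e2, Finset.sum_congr rfl e3] at this

lemma sum_sum_mul_sum_comm {α β γ : Type*} (s : Finset α) (t : Finset β) (r : Finset γ)
    (c : α → β → ℝ) (F : γ → α → β → ℝ) :
    ∑ j ∈ s, ∑ x ∈ t, c j x * ∑ p ∈ r, F p j x = ∑ p ∈ r, ∑ j ∈ s, ∑ x ∈ t, c j x * F p j x := by
  simp only [Finset.mul_sum]
  rw [Finset.sum_comm (s := r)]
  exact Finset.sum_congr rfl fun j _ => Finset.sum_comm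

/-- A Cauchy-Schwarz bound for the gradient of a function whose gradient is the sum of a term `σ`
of order zero and of a divergence. -/
lemma sum_fwdDif_sq_le_of_eq (e : ι → G) {u : G → ℝ} {σ : ι → G → ℝ} {R : ι → ι → G → ℝ}
    (hu : ∀ i, fwdDif (e i) u = σ i + ∑ l, fwdDif (e l) (R i l)) (x : G) :
    (∑ i, (fwdDif (e i) u x) ^ 2) / (Fintype.card ι + 1) ≤
      ∑ i, (σ i x) ^ 2 + ∑ i, ∑ l, (fwdDif (e l) (R i l) x) ^ 2 := by
  rw [div_le_iff₀ (by positivity), ← Finset.sum_add_distrib, Finset.sum_mul]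
  refine Finset.sum_le_sum fun i _ => ?_
  have h := sq_sum_le_card_mul_sum_sq (s := (Finset.univ : Finset (Option ι)))
    (f := fun o => o.elim (σ i x) fun l => fwdDif (e l) (R i l) x)
  simp only [Fintype.sum_option, Option.elim, Finset.card_univ, Fintype.card_option] at h
  rw [hu]
  simp only [Pi.add_apply, Finset.sum_apply]
  push_cast at h
  linarith

lemma sum_fwdDif_sq_le' (e : ι → G) (f : G → ℝ) (x : G) (i : ι) :
    (fwdDif (e i) f x) ^ 2 ≤
      (Fintype.card ι + 1) ^ 2 * (walkAvg e (f ^ 2) x - (walkAvg e f x) ^ 2) :=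
  (Finset.single_le_sum (f := fun i => (fwdDif (e i) f x) ^ 2) (fun _ _ => sq_nonneg _)
    (Finset.mem_univ i)).trans (sum_fwdDif_sq_le e f x)

lemma sum_walkAvg_pow_sq_le [Fintype G] (e : ι → G) (n : ℕ) {κ : ℝ}
    (hκ : ∀ f : G → ℝ, 0 ≤ f → ∀ x, (walkAvg e ^ n) f x ≤ κ * ∑ y, f y) {f : G → ℝ} (hf : 0 ≤ f) :
    ∑ x, ((walkAvg e ^ n) f x) ^ 2 ≤ κ * (∑ x, f x) ^ 2 := by
  calc ∑ x, ((walkAvg e ^ n) f x) ^ 2 ≤ ∑ x, (κ * ∑ y, f y) * (walkAvg e ^ n) f x := by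
        refine Finset.sum_le_sum fun x _ => ?_
        rw [sq]
        exact mul_le_mul_of_nonneg_right (hκ f hf x) (walkAvg_pow_nonneg e hf n x)
    _ = κ * (∑ x, f x) ^ 2 := by rw [← Finset.mul_sum, sum_walkAvg_pow]; ring

/-- The discrete estimate: a nonnegative function `u` whose gradient is a small divergence up to a
small error puts little mass on sets `X` of small cardinality. -/
theorem sum_le_of_fwdDif_eq [Fintype G] (e : ι → G) (n : ℕ) {κ A B : ℝ} (hκ0 : 0 < κ)
    (hκ : ∀ f : G → ℝ, 0 ≤ f → ∀ x, (walkAvg e ^ n) f x ≤ κ * ∑ y, f y)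
    {u : G → ℝ} (hu0 : 0 ≤ u) {σ : ι → G → ℝ} {R : ι → ι → G → ℝ}
    (hu : ∀ i, fwdDif (e i) u = σ i + ∑ l, fwdDif (e l) (R i l))
    (hA : ∑ x, ∑ i, ∑ l, |R i l x| + √n * ∑ x, ∑ i, |σ i x| ≤ A) (hAB : A ≤ B) (hB : 0 < B)
    (X : Finset G) :
    ∑ x ∈ X, u x ≤
      √(A / B * (∑ x, u x) ^ 2 + 2 * (Fintype.card ι + 1) ^ 3 * A ^ 2) +
      √(X.card * (κ * ((∑ x, u x) ^ 2 + 2 * (Fintype.card ι + 1) ^ 3 * (A * B)))) := by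
  set q : ℝ := Fintype.card ι + 1 with hq
  have hq1 : 1 ≤ q := by rw [hq]; linarith [Nat.cast_nonneg (α := ℝ) (Fintype.card ι)]
  set m := ∑ x, u x
  set T := κ * B with hTdef
  have hT0 : 0 < T := by positivity
  set s : G → ℝ := ∑ i, |σ i| with hs
  set r : G → ℝ := ∑ i, ∑ l, |R i l| with hr
  have hs0 : 0 ≤ s := Finset.sum_nonneg fun i _ => abs_nonneg _
  have hr0 : 0 ≤ r := Finset.sum_nonneg fun i _ => Finset.sum_nonneg fun l _ => abs_nonneg _
  set a : G → ℝ := r + √n • s with ha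
  have ha0 : 0 ≤ a := add_nonneg hr0 (smul_nonneg (Real.sqrt_nonneg _) hs0)
  have hsumA : ∑ x, a x ≤ A := by
    refine le_trans (le_of_eq ?_) hA
    simp [ha, hr, hs, Finset.sum_add_distrib, Finset.mul_sum]
  have hss0 : 0 ≤ ∑ x, s x := Finset.sum_nonneg fun x _ => hs0 x
  have hsumS : √n * ∑ x, s x ≤ A := by
    refine le_trans ?_ hsumA
    simp only [ha, Pi.add_apply, Pi.smul_apply, smul_eq_mul, Finset.sum_add_distrib,
      ← Finset.mul_sum]
    linarith [Finset.sum_nonneg fun x (_ : x ∈ Finset.univ) => hr0 x]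
  set W := fun (j : ℕ) (f : G → ℝ) => (walkAvg e ^ j) f with hW
  have hW0 (f : G → ℝ) : W 0 f = f := rfl
  have hWs (j : ℕ) (f : G → ℝ) : W (j + 1) f = walkAvg e (W j f) := walkAvg_pow_succ e f j
  have hWa (j : ℕ) : W j a = W j r + √n • W j s := by simp [hW, ha]
  have hWn (j : ℕ) {f : G → ℝ} (hf : 0 ≤ f) : 0 ≤ W j f := walkAvg_pow_nonneg e hf j
  have hWT (x : G) : W n a x ≤ T :=
    (hκ a ha0 x).trans (by rw [hTdef]; gcongr; exact hsumA.trans hAB)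
  obtain ⟨P, Q, hPn, hP, hQ⟩ := exists_killed_walk e (fun j => W j a) T n
    (fun j => hWn j ha0) (fun j => (hWs j a).symm) hWT
  have hPQ : ∀ j < n, ∀ x, P j x + Q j x = walkAdj e (P (j + 1)) x := fun j hj x => (hQ j hj x).2.2
  have tel := sum_killed_walk e n hPQ
  have tel0 (f : G → ℝ) : ∑ x, P 0 x * f x + ∑ j ∈ Finset.range n, ∑ x, Q j x * W j f x =
      ∑ x, f x := by
    have h := tel fun j => W j f
    simp only [hWs, sub_self, mul_zero, Finset.sum_const_zero, hPn, Pi.one_apply, one_mul] at h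
    have h2 : ∑ x, W n f x = ∑ x, f x := sum_walkAvg_pow e f n
    rw [hW0] at h
    linarith
  have telsq (f : G → ℝ) : ∑ j ∈ Finset.range n, ∑ x, P (j + 1) x *
        (walkAvg e (W j f ^ 2) x - (walkAvg e (W j f) x) ^ 2) =
      ∑ x, P 0 x * f x ^ 2 + ∑ j ∈ Finset.range n, ∑ x, Q j x * W j f x ^ 2 -
        ∑ x, W n f x ^ 2 := by
    have h := tel fun j => W j f ^ 2
    simpa only [hWs, Pi.pow_apply, hPn, Pi.one_apply, one_mul, hW0] using h
  have hQ0 {j : ℕ} (hj : j ∈ Finset.range n) (x : G) : 0 ≤ Q j x :=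
    (hQ j (Finset.mem_range.1 hj) x).1
  have hP0 {j : ℕ} (hj : j ∈ Finset.range n) (x : G) : 0 ≤ P (j + 1) x :=
    (hP (j + 1) (Finset.mem_range.1 hj) x).1
  -- the divergence part of the energy
  have hRa (i l : ι) (j : ℕ) (x : G) : 0 ≤ W j |R i l| x := hWn j (abs_nonneg _) x
  have hsumR (j : ℕ) (x : G) : ∑ i, ∑ l, W j |R i l| x = W j r x := by
    simp [hW, hr]
  have hra (j : ℕ) (x : G) : W j r x ≤ W j a x := by
    rw [hWa]
    have := mul_nonneg (Real.sqrt_nonneg (n : ℝ)) (hWn j hs0 x)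
    simpa using this
  have hRsq (j : ℕ) (x : G) : ∑ i, ∑ l, W j (R i l) x ^ 2 ≤ W j a x ^ 2 := by
    calc ∑ i, ∑ l, W j (R i l) x ^ 2 ≤ ∑ i, ∑ l, W j |R i l| x ^ 2 := by
          refine Finset.sum_le_sum fun i _ => Finset.sum_le_sum fun l _ => ?_
          rw [← sq_abs]
          exact pow_le_pow_left₀ (abs_nonneg _) (abs_walkAvg_pow_le e _ j x) 2
      _ ≤ (∑ i, ∑ l, W j |R i l| x) ^ 2 := by
          rw [← Finset.sum_product', ← Finset.sum_product']
          exact Finset.sum_sq_le_sq_sum_of_nonneg fun p _ => hRa p.1 p.2 j x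
      _ ≤ W j a x ^ 2 := by
          rw [hsumR]
          exact pow_le_pow_left₀ (hWn j hr0 x) (hra j x) 2
  have hdiv : ∑ j ∈ Finset.range n, ∑ x, P (j + 1) x *
      ∑ i, ∑ l, (fwdDif (e l) (W j (R i l)) x) ^ 2 ≤ q ^ 3 * (T * A) := by
    calc _ ≤ ∑ j ∈ Finset.range n, ∑ x, P (j + 1) x * ∑ i, ∑ l, (q ^ 2 *
          (walkAvg e (W j (R i l) ^ 2) x - (walkAvg e (W j (R i l)) x) ^ 2)) := by
          gcongr with j hj x _ i _ l _
          · exact hP0 hj x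
          · exact sum_fwdDif_sq_le' e _ x l
      _ = q ^ 2 * ∑ i, ∑ l, ∑ j ∈ Finset.range n, ∑ x, P (j + 1) x *
          (walkAvg e (W j (R i l) ^ 2) x - (walkAvg e (W j (R i l)) x) ^ 2) := by
          simp only [← Finset.mul_sum, mul_left_comm _ (q ^ 2)]
          rw [sum_sum_mul_sum_comm]
          simp only [sum_sum_mul_sum_comm]
      _ ≤ q ^ 2 * ∑ i, ∑ l, (∑ x, P 0 x * R i l x ^ 2 +
            ∑ j ∈ Finset.range n, ∑ x, Q j x * W j (R i l) x ^ 2) := by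
          gcongr with i _ l _
          rw [telsq]
          linarith [Finset.sum_nonneg fun x (_ : x ∈ Finset.univ) => sq_nonneg (W n (R i l) x)]
      _ = q ^ 2 * (∑ x, P 0 x * ∑ i, ∑ l, W 0 (R i l) x ^ 2 +
            ∑ j ∈ Finset.range n, ∑ x, Q j x * ∑ i, ∑ l, W j (R i l) x ^ 2) := by
          have h0 := sum_sum_mul_sum_comm (Finset.range 1) Finset.univ Finset.univ
            (fun _ x => P 0 x) (fun i _ x => ∑ l, W 0 (R i l) x ^ 2)
          have h1 (i : ι) := sum_sum_mul_sum_comm (Finset.range 1) Finset.univ Finset.univ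
            (fun _ x => P 0 x) (fun l _ x => W 0 (R i l) x ^ 2)
          simp only [Finset.range_one, Finset.sum_singleton] at h0 h1
          rw [h0]
          simp only [h1]
          simp only [sum_sum_mul_sum_comm, Finset.sum_add_distrib, hW0]
      _ ≤ q ^ 2 * (∑ x, P 0 x * (q * T * a x) +
            ∑ j ∈ Finset.range n, ∑ x, Q j x * (q * T * W j a x)) := by
          have key (j : ℕ) (x : G) (p : ℝ) (hp : 0 ≤ p) (hpa : p ≠ 0 → W j a x ≤ q * T) :
              p * ∑ i, ∑ l, W j (R i l) x ^ 2 ≤ p * (q * T * W j a x) := by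
            rcases eq_or_ne p 0 with rfl | hp'
            · simp
            · refine mul_le_mul_of_nonneg_left ((hRsq j x).trans ?_) hp
              rw [sq]
              exact mul_le_mul_of_nonneg_right (hpa hp') (hWn j ha0 x)
          refine mul_le_mul_of_nonneg_left (add_le_add (Finset.sum_le_sum fun x _ => ?_)
            (Finset.sum_le_sum fun j hj => Finset.sum_le_sum fun x _ => ?_)) (by positivity)
          · refine key 0 x _ (hP 0 (Nat.zero_le n) x).1 fun h => ?_
            exact ((hP 0 (Nat.zero_le n) x).2.2 h).trans (le_mul_of_one_le_left hT0.le hq1)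
          · exact key j x _ (hQ0 hj x) fun h => ((hQ j (Finset.mem_range.1 hj) x).2.1 h).2
      _ = q ^ 3 * (T * (∑ x, P 0 x * a x +
            ∑ j ∈ Finset.range n, ∑ x, Q j x * W j a x)) := by
          simp only [mul_left_comm _ (q * T), ← Finset.mul_sum]
          ring
      _ ≤ q ^ 3 * (T * A) := by
          rw [tel0]; gcongr
  -- the part of order zero of the energy
  have hσsq (j : ℕ) (x : G) : ∑ i, W j (σ i) x ^ 2 ≤ W j s x ^ 2 := by
    calc ∑ i, W j (σ i) x ^ 2 ≤ ∑ i, W j |σ i| x ^ 2 := by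
          refine Finset.sum_le_sum fun i _ => ?_
          rw [← sq_abs]
          exact pow_le_pow_left₀ (abs_nonneg _) (abs_walkAvg_pow_le e _ j x) 2
      _ ≤ (∑ i, W j |σ i| x) ^ 2 :=
          Finset.sum_sq_le_sq_sum_of_nonneg fun i _ => hWn j (abs_nonneg _) x
      _ = W j s x ^ 2 := by simp [hW, hs]
  have hsa (j : ℕ) (x : G) : √n * W j s x ≤ W j a x := by
    rw [hWa]
    simpa using hWn j hr0 x
  have hzero : ∑ j ∈ Finset.range n, ∑ x, P (j + 1) x * ∑ i, W j (σ i) x ^ 2 ≤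
      q * (T * A) := by
    rcases Nat.eq_zero_or_pos n with hn | hn
    · subst hn
      simp only [Finset.range_zero, Finset.sum_empty]
      have : 0 ≤ A := (Finset.sum_nonneg fun x _ => ha0 x).trans hsumA
      positivity
    have hn' : 0 < √(n : ℝ) := Real.sqrt_pos.2 (by exact_mod_cast hn)
    have key : ∀ j ∈ Finset.range n, ∑ x, P (j + 1) x * ∑ i, W j (σ i) x ^ 2 ≤
        (q * T * ∑ x, s x) / √n := by
      intro j hj
      rw [le_div_iff₀ hn', Finset.sum_mul, ← sum_walkAvg_pow e s j, Finset.mul_sum]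
      refine Finset.sum_le_sum fun x _ => ?_
      obtain ⟨p0, p1, p2⟩ := hP (j + 1) (Finset.mem_range.1 hj) x
      have hsj := hWn j hs0 x
      rcases eq_or_ne (P (j + 1) x) 0 with h | h
      · rw [h, zero_mul, zero_mul]
        exact mul_nonneg (by positivity) hsj
      · calc P (j + 1) x * (∑ i, W j (σ i) x ^ 2) * √n ≤ 1 * (W j s x) ^ 2 * √n := by
              gcongr
              exact hσsq j x
          _ = (√n * W j s x) * W j s x := by ring
          _ ≤ (√n * (q * W (j + 1) s x)) * W j s x := by
              gcongr
              rw [hWs]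
              exact le_walkAvg e (hWn j hs0) x
          _ = q * (√n * W (j + 1) s x) * W j s x := by ring
          _ ≤ q * T * W j s x := by
              gcongr
              exact (hsa _ x).trans (p2 h)
    refine (Finset.sum_le_sum key).trans ?_
    rw [Finset.sum_const, Finset.card_range, nsmul_eq_mul]
    calc (n : ℝ) * (q * T * (∑ x, s x) / √n) = q * T * ((n / √n) * ∑ x, s x) := by ring
      _ = q * T * (√n * ∑ x, s x) := by rw [Real.div_sqrt]
      _ ≤ q * T * A := by gcongr
      _ = q * (T * A) := by ring
  -- the energy estimate
  have hA0 : 0 ≤ A := (Finset.sum_nonneg fun x _ => ha0 x).trans hsumA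
  have henergy : ∑ x, P 0 x * u x ^ 2 + ∑ j ∈ Finset.range n, ∑ x, Q j x * W j u x ^ 2 ≤
      κ * (m ^ 2 + 2 * q ^ 3 * (A * B)) := by
    have h1 := telsq u
    have h2 : ∑ x, W n u x ^ 2 ≤ κ * m ^ 2 := sum_walkAvg_pow_sq_le e n hκ hu0
    have h3 : ∑ j ∈ Finset.range n, ∑ x, P (j + 1) x *
        (walkAvg e (W j u ^ 2) x - (walkAvg e (W j u) x) ^ 2) ≤
        ∑ j ∈ Finset.range n, ∑ x, P (j + 1) x * ∑ i, W j (σ i) x ^ 2 +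
        ∑ j ∈ Finset.range n, ∑ x, P (j + 1) x *
          ∑ i, ∑ l, (fwdDif (e l) (W j (R i l)) x) ^ 2 := by
      simp only [← Finset.sum_add_distrib, ← mul_add]
      gcongr with j hj x _
      · exact hP0 hj x
      · refine (walkAvg_sq_sub_le e _ x).trans ?_
        have hj : ∀ i, fwdDif (e i) (W j u) =
            W j (σ i) + ∑ l, fwdDif (e l) (W j (R i l)) := fun i => by
          simp only [hW, ← walkAvg_pow_fwdDif, hu, map_add, map_sum]
        have := sum_fwdDif_sq_le_of_eq e hj x
        simpa only [Finset.sum_add_distrib] using this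
    have h4 : q ≤ q ^ 3 := le_self_pow₀ hq1 (by norm_num)
    have h5 : q * (T * A) ≤ q ^ 3 * (T * A) := by gcongr
    have h6 : κ * (m ^ 2 + 2 * q ^ 3 * (A * B)) = κ * m ^ 2 + 2 * (q ^ 3 * (T * A)) := by
      rw [hTdef]; ring
    linarith
  have hkill : ∑ j ∈ Finset.range n, ∑ x, Q j x ≤ A / T := by
    rw [le_div_iff₀ hT0]
    calc (∑ j ∈ Finset.range n, ∑ x, Q j x) * T
        = ∑ j ∈ Finset.range n, ∑ x, Q j x * T := by simp only [Finset.sum_mul]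
      _ ≤ ∑ j ∈ Finset.range n, ∑ x, Q j x * W j a x := by
          refine Finset.sum_le_sum fun j hj => Finset.sum_le_sum fun x _ => ?_
          rcases eq_or_ne (Q j x) 0 with h | h
          · simp [h]
          · exact mul_le_mul_of_nonneg_left ((hQ j (Finset.mem_range.1 hj) x).2.1 h).1 (hQ0 hj x)
      _ ≤ A := by
          have := tel0 a
          have h0 : 0 ≤ ∑ x, P 0 x * a x :=
            Finset.sum_nonneg fun x _ => mul_nonneg (hP 0 (Nat.zero_le n) x).1 (ha0 x)
          linarith
  have hQE : 0 ≤ ∑ j ∈ Finset.range n, ∑ x, Q j x * W j u x ^ 2 :=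
    Finset.sum_nonneg fun j hj => Finset.sum_nonneg fun x _ => mul_nonneg (hQ0 hj x) (sq_nonneg _)
  have hPE : 0 ≤ ∑ x, P 0 x * u x ^ 2 :=
    Finset.sum_nonneg fun x _ => mul_nonneg (hP 0 (Nat.zero_le n) x).1 (sq_nonneg _)
  have hkilled : ∑ j ∈ Finset.range n, ∑ x, Q j x * W j u x ≤
      √(A / B * m ^ 2 + 2 * q ^ 3 * A ^ 2) := by
    have h := sum_le_sqrt_mul (Finset.range n ×ˢ Finset.univ) (fun p : ℕ × G => Q p.1 p.2)
      (fun p => W p.1 u p.2) fun p hp => hQ0 (Finset.mem_product.1 hp).1 p.2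
    simp only [Finset.sum_product] at h
    refine h.trans (Real.sqrt_le_sqrt ?_)
    calc _ ≤ A / T * (κ * (m ^ 2 + 2 * q ^ 3 * (A * B))) := by
          gcongr
          linarith
      _ = A / B * m ^ 2 + 2 * q ^ 3 * A ^ 2 := by
          rw [hTdef]; field_simp
  have hsurv : ∑ x ∈ X, P 0 x * u x ≤ √(X.card * (κ * (m ^ 2 + 2 * q ^ 3 * (A * B)))) := by
    refine (sum_le_sqrt_mul X (P 0) u fun x _ => (hP 0 (Nat.zero_le n) x).1).trans
      (Real.sqrt_le_sqrt ?_)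
    gcongr
    · exact Finset.sum_nonneg fun x _ => mul_nonneg (hP 0 (Nat.zero_le n) x).1 (sq_nonneg _)
    · calc ∑ x ∈ X, P 0 x ≤ ∑ x ∈ X, 1 := Finset.sum_le_sum fun x _ => (hP 0 (Nat.zero_le n) x).2.1
        _ = X.card := by simp
    · calc ∑ x ∈ X, P 0 x * u x ^ 2 ≤ ∑ x, P 0 x * u x ^ 2 :=
          Finset.sum_le_univ_sum_of_nonneg
            fun x => mul_nonneg (hP 0 (Nat.zero_le n) x).1 (sq_nonneg _)
        _ ≤ _ := by linarith
  have hrest : ∑ x ∈ X, (1 - P 0 x) * u x ≤ ∑ j ∈ Finset.range n, ∑ x, Q j x * W j u x := by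
    have h := tel0 u
    calc ∑ x ∈ X, (1 - P 0 x) * u x ≤ ∑ x, (1 - P 0 x) * u x :=
          Finset.sum_le_univ_sum_of_nonneg
            fun x => mul_nonneg (sub_nonneg.2 (hP 0 (Nat.zero_le n) x).2.1) (hu0 x)
      _ = _ := by
          simp only [sub_mul, one_mul, Finset.sum_sub_distrib]
          linarith
  calc ∑ x ∈ X, u x = ∑ x ∈ X, (1 - P 0 x) * u x + ∑ x ∈ X, P 0 x * u x := by
        rw [← Finset.sum_add_distrib]
        exact Finset.sum_congr rfl fun x _ => by ring
    _ ≤ _ := add_le_add (hrest.trans hkilled) hsurv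

end Core

section HeatKernel

lemma factorial_mul_pow_le (k m : ℕ) : k.factorial * k ^ m ≤ m.factorial * k ^ k := by
  rcases le_total k m with h | h
  · calc k.factorial * k ^ m = k.factorial * k ^ (m - k) * k ^ k := by
          rw [mul_assoc, ← pow_add, Nat.sub_add_cancel h]
      _ ≤ m.factorial * k ^ k := by gcongr; exact Nat.factorial_mul_pow_sub_le_factorial h
  · have h1 := Nat.factorial_mul_descFactorial (Nat.sub_le k m)
    rw [Nat.sub_sub_self h] at h1
    calc k.factorial * k ^ m = m.factorial * (k.descFactorial (k - m) * k ^ m) := by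
          rw [← h1, mul_assoc]
      _ ≤ m.factorial * (k ^ (k - m) * k ^ m) := by gcongr; exact Nat.descFactorial_le_pow _ _
      _ = m.factorial * k ^ k := by rw [← pow_add, Nat.sub_add_cancel h]

/-- Multinomial coefficients are largest at the center. -/
lemma factorial_pow_mul_multinomial_le {α : Type*} (s : Finset α) (f : α → ℕ) {k : ℕ} (hk : 0 < k)
    (hf : ∑ i ∈ s, f i = s.card * k) :
    k.factorial ^ s.card * Nat.multinomial s f ≤ (s.card * k).factorial := by
  have h1 : k.factorial ^ s.card * k ^ (s.card * k) ≤ (∏ i ∈ s, (f i).factorial) *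
      k ^ (s.card * k) := by
    have := Finset.prod_le_prod' (s := s) fun i _ => factorial_mul_pow_le k (f i)
    rw [Finset.prod_mul_distrib, Finset.prod_mul_distrib, Finset.prod_pow_eq_pow_sum, hf] at this
    simpa [← pow_mul, mul_comm k] using this
  have h2 := Nat.le_of_mul_le_mul_right h1 (by positivity)
  rw [← hf, ← Nat.multinomial_spec s f]
  gcongr

lemma factorial_le_stirling {n : ℕ} (hn : 0 < n) :
    (n.factorial : ℝ) ≤ Real.exp 1 * √n * (n / Real.exp 1) ^ n := by
  obtain ⟨n, rfl⟩ := Nat.exists_eq_succ_of_ne_zero hn.ne'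
  have h := Stirling.stirlingSeq'_antitone (Nat.zero_le n)
  simp only [Function.comp_apply, Nat.succ_eq_add_one, zero_add, Stirling.stirlingSeq_one] at h
  rw [Stirling.stirlingSeq, div_le_iff₀ (by positivity)] at h
  refine h.trans (le_of_eq ?_)
  rw [Real.sqrt_mul (by norm_num)]
  field_simp

lemma factorial_div_le {q k : ℕ} (hq : 0 < q) (hk : 0 < k) :
    ((q * k).factorial : ℝ) ≤
      Real.exp 1 * √(q * k) / √k ^ q * (q ^ (q * k) * (k.factorial : ℝ) ^ q) := by
  have h1 := factorial_le_stirling (Nat.mul_pos hq hk)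
  have h2 : √k * (k / Real.exp 1) ^ k ≤ (k.factorial : ℝ) := by
    refine le_trans ?_ (Stirling.le_factorial_stirling k)
    gcongr
    have := Real.pi_gt_three
    nlinarith [Nat.cast_nonneg (α := ℝ) k]
  have h3 := pow_le_pow_left₀ (by positivity) h2 q
  have hk' : (0 : ℝ) < k := by exact_mod_cast hk
  calc ((q * k).factorial : ℝ)
      ≤ Real.exp 1 * √((q * k : ℕ) : ℝ) * (((q * k : ℕ) : ℝ) / Real.exp 1) ^ (q * k) := h1
    _ = Real.exp 1 * √(q * k) / √k ^ q * (q ^ (q * k) * (√k * (k / Real.exp 1) ^ k) ^ q) := by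
        have : √(k : ℝ) ≠ 0 := (Real.sqrt_pos.2 hk').ne'
        push_cast
        simp only [div_pow, mul_pow, ← pow_mul, mul_comm k q]
        field_simp
    _ ≤ _ := by gcongr

variable {G ι : Type*} [AddCommGroup G] [Fintype ι]

/-- Translations of functions on a group, as linear operators. -/
def translation (G : Type*) [AddCommGroup G] : Multiplicative G →* Module.End ℝ (G → ℝ) where
  toFun g := { toFun := fun f x => f (x + g.toAdd)
               map_add' := fun _ _ => rfl
               map_smul' := fun _ _ => rfl }
  map_one' := by ext; simp
  map_mul' g h := by
    ext f x
    simp [add_left_comm, add_comm]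

lemma translation_apply (g : G) (f : G → ℝ) (x : G) :
    translation G (.ofAdd g) f x = f (x + g) := rfl

lemma walkAvg_pow_eq_sum [DecidableEq ι] (e : ι → G) (f : G → ℝ) (x : G) (n : ℕ) :
    (Fintype.card ι + 1 : ℝ) ^ n * (walkAvg e ^ n) f x =
      ∑ k ∈ (Finset.univ : Finset (Option ι)).piAntidiag n,
        (Nat.multinomial Finset.univ k : ℝ) * f (x + ∑ i, k (some i) • e i) := by
  have h1 : (Fintype.card ι + 1 : ℝ) • walkAvg e = AddMonoidAlgebra.lift ℝ _ G (translation G)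
      (∑ o : Option ι, AddMonoidAlgebra.single (o.elim 0 e) 1) := by
    ext f x
    rw [map_sum]
    simp only [LinearMap.smul_apply, Pi.smul_apply, walkAvg_apply, smul_eq_mul,
      LinearMap.add_apply, Pi.add_apply,
      AddMonoidAlgebra.lift_single, one_smul, LinearMap.sum_apply, Finset.sum_apply,
      Fintype.sum_option, translation_apply, Option.elim, add_zero]
    rw [mul_div_cancel₀ _ (by positivity)]
  have h2 := congrArg (fun T : Module.End ℝ (G → ℝ) => (T ^ n) f x) h1
  simp only [smul_pow, ← map_pow, LinearMap.smul_apply, Pi.smul_apply, smul_eq_mul] at h2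
  rw [h2, Finset.sum_pow_eq_sum_piAntidiag, map_sum, LinearMap.sum_apply, Finset.sum_apply]
  refine Finset.sum_congr rfl fun k _ => ?_
  simp only [AddMonoidAlgebra.single_pow, AddMonoidAlgebra.prod_single, one_pow,
    Finset.prod_const_one, map_mul, map_natCast, AddMonoidAlgebra.lift_single, one_smul,
    Fintype.sum_option, Option.elim, smul_zero, zero_add]
  rw [← nsmul_eq_mul, LinearMap.smul_apply, Pi.smul_apply, translation_apply, nsmul_eq_mul]

/-- The heat kernel bound for the lazy walk on a large discrete torus. -/
lemma walkAvg_pow_le_torus [DecidableEq ι] {M k : ℕ} (hk : 0 < k)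
    (hM : (Fintype.card ι + 1) * k < M) [NeZero M] (f : (ι → ZMod M) → ℝ) (hf : 0 ≤ f)
    (x : ι → ZMod M) :
    (walkAvg (fun i : ι => (Pi.single i 1 : ι → ZMod M)) ^ ((Fintype.card ι + 1) * k)) f x ≤
      Real.exp 1 * √(Fintype.card ι + 1) / √k ^ Fintype.card ι * ∑ y, f y := by
  set q := Fintype.card ι + 1 with hq
  have h1 := walkAvg_pow_eq_sum (fun i : ι => (Pi.single i 1 : ι → ZMod M)) f x (q * k)
  have hv (c : Option ι → ℕ) (j : ι) :
      (∑ i, c (some i) • (Pi.single i 1 : ι → ZMod M)) j = (c (some j) : ZMod M) := by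
    simp [Finset.sum_apply, Pi.single_apply]
  set c := Real.exp 1 * √(q * k) / √k ^ q with hc
  have hcard : (Finset.univ : Finset (Option ι)).card = q := by simp [hq]
  have h2 : (q : ℝ) ^ (q * k) *
      (walkAvg (fun i : ι => (Pi.single i 1 : ι → ZMod M)) ^ (q * k)) f x ≤
      ∑ m ∈ (Finset.univ : Finset (Option ι)).piAntidiag (q * k),
        c * q ^ (q * k) * f (x + ∑ i, m (some i) • Pi.single i 1) := by
    have hq' : (Fintype.card ι + 1 : ℝ) = q := by simp [hq]
    rw [hq'] at h1
    rw [h1]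
    refine Finset.sum_le_sum fun m hm => mul_le_mul_of_nonneg_right ?_ (hf _)
    have h3 := factorial_pow_mul_multinomial_le Finset.univ m hk
      (by rw [hcard]; exact (Finset.mem_piAntidiag.1 hm).1)
    rw [hcard] at h3
    have h3' : (k.factorial : ℝ) ^ q * Nat.multinomial Finset.univ m ≤ ((q * k).factorial : ℝ) := by
      exact_mod_cast h3
    have h4 := h3'.trans (factorial_div_le (q := q) (Nat.succ_pos _) hk)
    have h5 : (0 : ℝ) < (k.factorial : ℝ) ^ q := by positivity
    rw [← hc] at h4
    exact le_of_mul_le_mul_left (by linarith) h5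
  have hinj : Set.InjOn (fun m : Option ι → ℕ => x + ∑ i, m (some i) • (Pi.single i 1 : ι → ZMod M))
      ((Finset.univ : Finset (Option ι)).piAntidiag (q * k)) := by
    intro m hm m' hm' hmm
    have hs := (Finset.mem_piAntidiag.1 (Finset.mem_coe.1 hm)).1
    have hs' := (Finset.mem_piAntidiag.1 (Finset.mem_coe.1 hm')).1
    have hlt {m : Option ι → ℕ} (h : ∑ i, m i = q * k) (o : Option ι) : m o < M :=
      ((Finset.single_le_sum (f := m) (fun _ _ => Nat.zero_le _) (Finset.mem_univ o)).trans
        h.le).trans_lt hM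
    have hsome (j : ι) : m (some j) = m' (some j) := by
      have := congrFun (add_left_cancel hmm) j
      rw [hv, hv, ZMod.natCast_eq_natCast_iff'] at this
      rwa [Nat.mod_eq_of_lt (hlt hs _), Nat.mod_eq_of_lt (hlt hs' _)] at this
    funext o
    rcases o with _ | j
    · rw [Fintype.sum_option] at hs hs'
      simp only [hsome] at hs
      omega
    · exact hsome j
  have h3 : ∑ m ∈ (Finset.univ : Finset (Option ι)).piAntidiag (q * k),
        f (x + ∑ i, m (some i) • Pi.single i 1) ≤ ∑ y, f y := by
    rw [← Finset.sum_image (f := f) hinj]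
    exact Finset.sum_le_univ_sum_of_nonneg hf
  rw [← Finset.mul_sum] at h2
  have hq0 : (0 : ℝ) < (q : ℝ) ^ (q * k) := by positivity
  have hk' : (0 : ℝ) < √(k : ℝ) := Real.sqrt_pos.2 (by exact_mod_cast hk)
  have hc' : c = Real.exp 1 * √(Fintype.card ι + 1) / √k ^ Fintype.card ι := by
    rw [hc, hq, pow_succ, Real.sqrt_mul (by positivity)]
    push_cast
    field_simp
  rw [← hc']
  refine le_of_mul_le_mul_left (h2.trans ?_) hq0
  rw [mul_comm c, mul_assoc]
  gcongr

end HeatKernel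

section Duality

variable {G ι : Type*} [AddCommGroup G] [Fintype ι] [Fintype G]

lemma linearMap_eq_sum_single {α : Type*} [Fintype α] [DecidableEq α] (g : (α → ℝ) →ₗ[ℝ] ℝ)
    (a : α → ℝ) : g a = ∑ x, a x * g (Pi.single x 1) := by
  rw [LinearMap.pi_apply_eq_sum_univ g a]
  refine Finset.sum_congr rfl fun x _ => ?_
  rw [smul_eq_mul]
  congr 2
  ext j
  simp [Pi.single_apply, eq_comm]

lemma sum_abs_le_of_linearMap_le {α : Type*} [Fintype α] [DecidableEq α] (g : (α → ℝ) →ₗ[ℝ] ℝ)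
    {c : ℝ} (hg : ∀ a : α → ℝ, (∀ x, |a x| ≤ 1) → g a ≤ c) : ∑ x, |g (Pi.single x 1)| ≤ c := by
  have h := hg (fun x => SignType.sign (g (Pi.single x 1))) fun x => by
    rcases lt_trichotomy (g (Pi.single x 1)) 0 with h | h | h <;> simp [h]
  rw [linearMap_eq_sum_single] at h
  simpa using h

/-- A functional controlled by the sup norms of a function and of its differences
is the sum of a measure and of a divergence. -/
theorem exists_eq_add_sum_fwdDif (e : ι → G) (w : G → ℝ) {α β : ℝ} (hα : 0 ≤ α) (hβ : 0 ≤ β)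
    (hw : ∀ (f : G → ℝ) (a b : ℝ), (∀ x, |f x| ≤ a) → 0 ≤ b → (∀ l x, |f x - f (x - e l)| ≤ b) →
      ∑ x, f x * w x ≤ α * a + β * b) :
    ∃ (σ : G → ℝ) (R : ι → G → ℝ), w = σ + ∑ l, fwdDif (e l) (R l) ∧
      ∑ x, |σ x| ≤ α ∧ ∑ x, ∑ l, |R l x| ≤ β := by
  classical
  let D : (G → ℝ) →ₗ[ℝ] (ι × G → ℝ) :=
    { toFun := fun f p => f p.2 - f (p.2 - e p.1)
      map_add' := fun f g => by ext p; simp only [Pi.add_apply]; ring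
      map_smul' := fun c f => by
        ext p; simp only [Pi.smul_apply, smul_eq_mul, RingHom.id_apply]; ring }
  let L : (G → ℝ) →ₗ[ℝ] ℝ :=
    { toFun := fun f => ∑ x, f x * w x
      map_add' := fun f g => by simp only [Pi.add_apply, add_mul, Finset.sum_add_distrib]
      map_smul' := fun c f => by
        simp only [Pi.smul_apply, smul_eq_mul, RingHom.id_apply, mul_assoc, Finset.mul_sum] }
  obtain ⟨g, hg, hgN⟩ := exists_extension_of_le_sublinear
    ((L.comp (LinearMap.fst ℝ (G → ℝ) (ι × G → ℝ))).toPMap D.graph)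
    (fun p => α * ‖p.1‖ + β * ‖p.2‖)
    (fun c hc p => by
      simp only [Prod.smul_fst, Prod.smul_snd, norm_smul, Real.norm_of_nonneg hc.le]; ring)
    (fun p p' => by
      have h1 := norm_add_le p.1 p'.1
      have h2 := norm_add_le p.2 p'.2
      have h3 := mul_le_mul_of_nonneg_left h1 hα
      have h4 := mul_le_mul_of_nonneg_left h2 hβ
      simp only [Prod.fst_add, Prod.snd_add]
      linarith)
    (by
      rintro ⟨p, hp⟩
      have hp' : p.2 = D p.1 := hp
      refine hw p.1 ‖p.1‖ ‖p.2‖ (fun x => norm_le_pi_norm p.1 x) (norm_nonneg _) fun l x => ?_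
      rw [hp']
      exact norm_le_pi_norm (D p.1) (l, x))
  let g₁ := g.comp (LinearMap.inl ℝ (G → ℝ) (ι × G → ℝ))
  let g₂ := g.comp (LinearMap.inr ℝ (G → ℝ) (ι × G → ℝ))
  have hgf (f : G → ℝ) : ∑ x, f x * w x = g₁ f + g₂ (D f) := by
    have h1 := hg ⟨(f, D f), rfl⟩
    have h2 : g (f, D f) = g₁ f + g₂ (D f) := by
      simp only [g₁, g₂, LinearMap.comp_apply, ← map_add]
      simp
    rw [← h2]
    exact h1.symm
  refine ⟨fun x => g₁ (Pi.single x 1), fun l x => - g₂ (Pi.single (l, x) 1), ?_, ?_, ?_⟩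
  · ext y
    have h := hgf (Pi.single y 1)
    rw [linearMap_eq_sum_single g₂, Fintype.sum_prod_type] at h
    have h1 : ∑ x, (Pi.single y 1 : G → ℝ) x * w x = w y := by simp [Pi.single_apply]
    rw [h1] at h
    rw [h, Pi.add_apply, Finset.sum_apply]
    congr 1
    refine Finset.sum_congr rfl fun l _ => ?_
    simp only [D, LinearMap.coe_mk, AddHom.coe_mk, sub_mul, Finset.sum_sub_distrib, fwdDif_apply,
      Pi.single_apply, sub_eq_iff_eq_add, ite_mul, one_mul, zero_mul, Finset.sum_ite_eq',
      Finset.mem_univ, if_true]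
    ring
  · refine sum_abs_le_of_linearMap_le g₁ fun a ha => ?_
    have h := hgN (a, 0)
    have h1 : ‖a‖ ≤ 1 := (pi_norm_le_iff_of_nonneg zero_le_one).2 ha
    simp only [norm_zero, mul_zero, add_zero] at h
    calc g₁ a ≤ α * ‖a‖ := h
      _ ≤ α * 1 := by gcongr
      _ = α := mul_one _
  · have h2 := sum_abs_le_of_linearMap_le g₂ (c := β) fun b hb => by
      have h := hgN (0, b)
      have h1 : ‖b‖ ≤ 1 := (pi_norm_le_iff_of_nonneg zero_le_one).2 hb
      simp only [norm_zero, mul_zero, zero_add] at h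
      calc g₂ b ≤ β * ‖b‖ := h
        _ ≤ β * 1 := by gcongr
        _ = β := mul_one _
    rw [Fintype.sum_prod_type_right] at h2
    simpa only [abs_neg] using h2

end Duality

section Mollify

variable {E : Type*} [NormedAddCommGroup E] [InnerProductSpace ℝ E] [FiniteDimensional ℝ E]
  [MeasurableSpace E] [BorelSpace E]

/-- A smooth probability density supported in the closed unit ball. -/
noncomputable def unitBump (E : Type*) [NormedAddCommGroup E] [InnerProductSpace ℝ E]
    [FiniteDimensional ℝ E] [MeasurableSpace E] [BorelSpace E] : E → ℝ :=
  (⟨1 / 2, 1, by norm_num, by norm_num⟩ : ContDiffBump (0 : E)).normed volume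

lemma unitBump_nonneg (t : E) : 0 ≤ unitBump E t := ContDiffBump.nonneg_normed _ t

lemma integral_unitBump : ∫ t, unitBump E t = 1 := ContDiffBump.integral_normed _

lemma contDiff_unitBump : ContDiff ℝ 1 (unitBump E) := ContDiffBump.contDiff_normed _

lemma hasCompactSupport_unitBump : HasCompactSupport (unitBump E) :=
  ContDiffBump.hasCompactSupport_normed _

lemma integrable_unitBump : Integrable (unitBump E) := ContDiffBump.integrable_normed _

lemma tsupport_unitBump : tsupport (unitBump E) = Metric.closedBall 0 1 :=
  ContDiffBump.tsupport_normed_eq _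

lemma unitBump_eq_zero {t : E} (ht : 1 < ‖t‖) : unitBump E t = 0 :=
  image_eq_zero_of_notMem_tsupport (by simpa [tsupport_unitBump] using ht)

lemma fderiv_unitBump_eq_zero {t : E} (ht : 1 < ‖t‖) : fderiv ℝ (unitBump E) t = 0 := by
  by_contra h
  have := support_fderiv_subset ℝ (f := unitBump E) h
  rw [tsupport_unitBump] at this
  simp at this
  linarith

/-- The mean of `F` with respect to the density `unitBump` centered at `y`. -/
noncomputable def mollify (F : E → ℝ) (y : E) : ℝ := ∫ t, unitBump E t * F (y - t)

lemma mollify_eq_convolution (F : E → ℝ) :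
    mollify F = convolution (unitBump E) F (ContinuousLinearMap.lsmul ℝ ℝ) := rfl

lemma integrable_unitBump_mul {F : E → ℝ} (hF : Measurable F) {B : ℝ} (hB : ∀ z, |F z| ≤ B)
    (y : E) : Integrable fun t => unitBump E t * F (y - t) :=
  integrable_unitBump.mul_bdd (c := B)
    (hF.comp (measurable_const.sub measurable_id)).aestronglyMeasurable
    (Filter.Eventually.of_forall fun t => hB (y - t))

lemma locallyIntegrable_of_bounded {F : E → ℝ} (hF : Measurable F) {B : ℝ} (hB : ∀ z, |F z| ≤ B) :
    LocallyIntegrable F := by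
  refine (locallyIntegrable_const B).mono hF.aestronglyMeasurable
    (Filter.Eventually.of_forall fun x => ?_)
  exact (hB x).trans (le_abs_self B)

lemma contDiff_mollify {F : E → ℝ} (hF : Measurable F) {B : ℝ} (hB : ∀ z, |F z| ≤ B) :
    ContDiff ℝ 1 (mollify F) :=
  hasCompactSupport_unitBump.contDiff_convolution_left (n := 1)
    (ContinuousLinearMap.lsmul ℝ ℝ) contDiff_unitBump (locallyIntegrable_of_bounded hF hB)

lemma mollify_const (c : ℝ) (y : E) : mollify (fun _ => c) y = c := by
  rw [mollify, integral_mul_const, integral_unitBump, one_mul]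

lemma mollify_add {F F' : E → ℝ} (hF : Measurable F) (hF' : Measurable F') {B B' : ℝ}
    (hB : ∀ z, |F z| ≤ B) (hB' : ∀ z, |F' z| ≤ B') (y : E) :
    mollify (F + F') y = mollify F y + mollify F' y := by
  rw [mollify, mollify, mollify, ← integral_add (integrable_unitBump_mul hF hB y)
    (integrable_unitBump_mul hF' hB' y)]
  simp only [Pi.add_apply, mul_add]

lemma mollify_smul (F : E → ℝ) (c : ℝ) (y : E) : mollify (c • F) y = c * mollify F y := by
  rw [mollify, mollify, ← integral_const_mul]
  simp only [Pi.smul_apply, smul_eq_mul, mul_left_comm]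

lemma mollify_nonneg {F : E → ℝ} (hF : ∀ z, 0 ≤ F z) (y : E) : 0 ≤ mollify F y :=
  integral_nonneg fun t => mul_nonneg (unitBump_nonneg t) (hF _)

lemma mollify_eq_zero {F : E → ℝ} {y : E} (hF : ∀ z, ‖z - y‖ ≤ 1 → F z = 0) :
    mollify F y = 0 := by
  rw [mollify, integral_eq_zero_of_ae]
  refine Filter.Eventually.of_forall fun t => ?_
  rcases lt_or_ge 1 ‖t‖ with h | h
  · simp [unitBump_eq_zero h]
  · simp [hF (y - t) (by simpa using h)]

lemma abs_mollify_le {F : E → ℝ} {B : ℝ} (hB : ∀ z, |F z| ≤ B) (y : E) : |mollify F y| ≤ B := by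
  have h := norm_integral_le_of_norm_le (f := fun t => unitBump E t * F (y - t))
    (integrable_unitBump.mul_const B) (Filter.Eventually.of_forall fun t => by
      rw [norm_mul, Real.norm_of_nonneg (unitBump_nonneg t)]
      exact mul_le_mul_of_nonneg_left (hB _) (unitBump_nonneg t))
  rwa [integral_mul_const, integral_unitBump, one_mul] at h

lemma norm_fderiv_mollify_le {F : E → ℝ} (hF : Measurable F) {B : ℝ} (hB : ∀ z, |F z| ≤ B)
    {y : E} {δ : ℝ} (hδ : ∀ z, ‖z - y‖ ≤ 1 → |F z - F y| ≤ δ) :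
    ‖fderiv ℝ (mollify F) y‖ ≤ (∫ t, ‖fderiv ℝ (unitBump E) t‖) * δ := by
  set c := F y
  set F₀ : E → ℝ := fun z => F z - c with hF₀
  have hF₀m : Measurable F₀ := hF.sub_const c
  have hB₀ : ∀ z, |F₀ z| ≤ B + |c| := fun z => (abs_sub _ _).trans (by linarith [hB z])
  have h1 : mollify F = fun z => mollify F₀ z + c := by
    ext z
    rw [← mollify_const c z, ← mollify_add hF₀m measurable_const hB₀ (fun _ => le_rfl)]
    congr 1
    ext z; simp [hF₀]
  have h2 := hasCompactSupport_unitBump.hasFDerivAt_convolution_left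
    (ContinuousLinearMap.lsmul ℝ ℝ) contDiff_unitBump (locallyIntegrable_of_bounded hF₀m hB₀) y
  rw [← mollify_eq_convolution] at h2
  rw [h1, (h2.add_const c).fderiv, convolution, ← integral_mul_const]
  have hc : Continuous (fderiv ℝ (unitBump E)) := contDiff_unitBump.continuous_fderiv one_ne_zero
  have hs : HasCompactSupport (fderiv ℝ (unitBump E)) := hasCompactSupport_unitBump.fderiv ℝ
  refine norm_integral_le_of_norm_le ((hc.integrable_of_hasCompactSupport hs).norm.mul_const δ)
    (Filter.Eventually.of_forall fun t => ?_)
  rcases lt_or_ge 1 ‖t‖ with h | h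
  · simp [fderiv_unitBump_eq_zero h]
  · have h3 : |F₀ (y - t)| ≤ δ := hδ _ (by simpa using h)
    refine ContinuousLinearMap.opNorm_le_bound _ (mul_nonneg (norm_nonneg _)
      ((abs_nonneg _).trans h3)) fun v => ?_
    rw [ContinuousLinearMap.precompL_apply, ContinuousLinearMap.lsmul_apply, smul_eq_mul, norm_mul]
    calc ‖fderiv ℝ (unitBump E) t v‖ * ‖F₀ (y - t)‖
        ≤ ‖fderiv ℝ (unitBump E) t‖ * ‖v‖ * δ := by
          gcongr
          · exact ContinuousLinearMap.le_opNorm _ _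
          · exact h3
      _ = _ := by ring

end Mollify

section Shift

variable {E : Type*} [NormedAddCommGroup E] [InnerProductSpace ℝ E] [FiniteDimensional ℝ E]
  [MeasurableSpace E] [BorelSpace E]

/-- The distributional derivative of `ν` in direction `v`, tested against `C¹` functions, is at most
`C` times the sup norm plus `ε` times the sup norm of the gradient. -/
def DerivBound (ν : Measure E) (v : E) (C ε : ℝ) : Prop :=
  ∀ (g : E → ℝ) (a b : ℝ), ContDiff ℝ 1 g → (∀ x, |g x| ≤ a) → (∀ x, ‖fderiv ℝ g x‖ ≤ b) →
    |∫ x, fderiv ℝ g x v ∂ν| ≤ C * a + ε * b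

omit [InnerProductSpace ℝ E] [FiniteDimensional ℝ E] in
lemma integrable_of_abs_le {ν : Measure E} [IsFiniteMeasure ν] {g : E → ℝ} (hg : Continuous g)
    {a : ℝ} (ha : ∀ x, |g x| ≤ a) : Integrable g ν :=
  Integrable.of_bound hg.aestronglyMeasurable a (Filter.Eventually.of_forall ha)

omit [FiniteDimensional ℝ E] in
lemma DerivBound.abs_integral_sub_le {ν : Measure E} [IsFiniteMeasure ν] {v : E} {C ε : ℝ}
    (hν : DerivBound ν v C ε) {g : E → ℝ} {a b : ℝ} (hg : ContDiff ℝ 1 g) (ha : ∀ x, |g x| ≤ a)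
    (hb : ∀ x, ‖fderiv ℝ g x‖ ≤ b) (h : ℝ) :
    |∫ x, (g (x + h • v) - g x) ∂ν| ≤ (C * a + ε * b) * |h| := by
  have hd : Differentiable ℝ g := hg.differentiable one_ne_zero
  have hc : Continuous (fderiv ℝ g) := hg.continuous_fderiv one_ne_zero
  have hInt : ∀ s : ℝ, Integrable (fun x => g (x + s • v)) ν := fun s =>
    integrable_of_abs_le (hg.continuous.comp (by fun_prop)) fun x => ha _
  have key : ∀ s : ℝ, HasDerivAt (fun s : ℝ => ∫ x, g (x + s • v) ∂ν)
      (∫ x, fderiv ℝ g (x + s • v) v ∂ν) s := by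
    intro s
    refine (hasDerivAt_integral_of_dominated_loc_of_deriv_le (bound := fun _ => b * ‖v‖)
      (F := fun (s : ℝ) (x : E) => g (x + s • v))
      (F' := fun (s : ℝ) (x : E) => fderiv ℝ g (x + s • v) v) Filter.univ_mem
      (Filter.Eventually.of_forall fun s => (hInt s).aestronglyMeasurable) (hInt s) ?_ ?_
      (integrable_const _) ?_).2
    · refine Continuous.aestronglyMeasurable ?_
      exact (hc.comp (by fun_prop : Continuous fun x : E => x + s • v)).clm_apply continuous_const
    · refine Filter.Eventually.of_forall fun x t _ => ?_
      exact (ContinuousLinearMap.le_opNorm _ _).trans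
        (mul_le_mul_of_nonneg_right (hb _) (norm_nonneg _))
    · refine Filter.Eventually.of_forall fun x t _ => ?_
      have h1 : HasDerivAt (fun t : ℝ => x + t • v) v t := by
        simpa using ((hasDerivAt_id t).smul_const v).const_add x
      exact (hd _).hasFDerivAt.comp_hasDerivAt t h1
  have hbd : ∀ s : ℝ, ‖∫ x, fderiv ℝ g (x + s • v) v ∂ν‖ ≤ C * a + ε * b := by
    intro s
    have h1 : ∀ x, fderiv ℝ (fun y => g (y + s • v)) x = fderiv ℝ g (x + s • v) := fun x =>
      fderiv_comp_add_right _
    have := hν (fun y => g (y + s • v)) a b (hg.comp (by fun_prop)) (fun x => ha _)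
      (fun x => by rw [h1]; exact hb _)
    rw [Real.norm_eq_abs]
    simpa only [h1] using this
  have := convex_univ.norm_image_sub_le_of_norm_hasDerivWithin_le (f := fun s : ℝ =>
    ∫ x, g (x + s • v) ∂ν) (fun s _ => (key s).hasDerivWithinAt) (fun s _ => hbd s)
    (Set.mem_univ 0) (Set.mem_univ h)
  rw [integral_sub (hInt h) (integrable_of_abs_le hg.continuous ha)]
  simpa using this

end Shift

section Torus

variable {d : ℕ}

/-- The residue class modulo `M` of the integer cell containing a point. -/
noncomputable def torusProj (M : ℕ) (z : EuclideanSpace ℝ (Fin d)) : Fin d → ZMod M :=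
  fun i => (⌊z i⌋ : ZMod M)

lemma measurable_comp_torusProj {M : ℕ} (f : (Fin d → ZMod M) → ℝ) :
    Measurable (f ∘ torusProj M) := by
  have h1 : Measurable fun z : EuclideanSpace ℝ (Fin d) => fun i => ⌊z i⌋ :=
    measurable_pi_lambda _ fun i => Int.measurable_floor.comp (by fun_prop)
  exact (Measurable.of_discrete (f := fun k : Fin d → ℤ => f fun i => (k i : ZMod M))).comp h1

lemma torusProj_sub_single {M : ℕ} (z : EuclideanSpace ℝ (Fin d)) (i : Fin d) :
    torusProj M (z - EuclideanSpace.single i 1) = torusProj M z - Pi.single i 1 := by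
  ext j
  rcases eq_or_ne j i with rfl | h
  · simp [torusProj]
  · simp [torusProj, h]

lemma abs_sub_le_card_mul {M : ℕ} {f : (Fin d → ZMod M) → ℝ} {b : ℝ}
    (hf : ∀ l x, |f x - f (x - Pi.single l 1)| ≤ b) (g h : Fin d → ZMod M)
    (hgh : ∀ i, g i = h i ∨ g i = h i + 1 ∨ h i = g i + 1) : |f g - f h| ≤ d * b := by
  suffices H : ∀ (s : Finset (Fin d)) (g : Fin d → ZMod M), (∀ i ∉ s, g i = h i) →
      (∀ i, g i = h i ∨ g i = h i + 1 ∨ h i = g i + 1) → |f g - f h| ≤ s.card * b by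
    simpa using H Finset.univ g (by simp) hgh
  intro s
  induction s using Finset.induction_on with
  | empty =>
    intro g hg _
    simp [show g = h from funext fun i => hg i (Finset.notMem_empty i)]
  | insert i s hi ih =>
    intro g hg hgh
    have h1 := ih (Function.update g i (h i)) (fun j hj => by
        rcases eq_or_ne j i with rfl | hji
        · simp
        · rw [Function.update_of_ne hji]; exact hg j (by simp [hji, hj])) fun j => by
        rcases eq_or_ne j i with rfl | hji
        · simp
        · rw [Function.update_of_ne hji]; exact hgh j
    have h2 : |f g - f (Function.update g i (h i))| ≤ b := by
      rcases hgh i with hh | hh | hh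
      · rw [← hh, Function.update_eq_self, sub_self, abs_zero]
        exact (abs_nonneg _).trans (hf i g)
      · convert hf i g using 4
        ext j
        rcases eq_or_ne j i with rfl | hji
        · simp [hh]
        · simp [hji]
      · rw [abs_sub_comm]
        convert hf i (Function.update g i (h i)) using 4
        ext j
        rcases eq_or_ne j i with rfl | hji
        · simp [hh]
        · simp [hji]
    rw [Finset.card_insert_of_notMem hi]
    push_cast
    linarith [abs_sub_le (f g) (f (Function.update g i (h i))) (f h)]

lemma abs_comp_torusProj_sub_le {M : ℕ} {f : (Fin d → ZMod M) → ℝ} {b : ℝ}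
    (hf : ∀ l x, |f x - f (x - Pi.single l 1)| ≤ b) {z y : EuclideanSpace ℝ (Fin d)}
    (h : ‖z - y‖ ≤ 1) : |f (torusProj M z) - f (torusProj M y)| ≤ d * b := by
  refine abs_sub_le_card_mul hf _ _ fun i => ?_
  have h1 : |z i - y i| ≤ 1 := (PiLp.norm_apply_le (z - y) i).trans h
  rw [abs_le] at h1
  have h2 : ⌊z i⌋ ≤ ⌊y i⌋ + 1 := by
    rw [← Int.floor_add_one]; exact Int.floor_mono (by linarith)
  have h3 : ⌊y i⌋ ≤ ⌊z i⌋ + 1 := by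
    rw [← Int.floor_add_one]; exact Int.floor_mono (by linarith)
  have h4 : ⌊z i⌋ = ⌊y i⌋ ∨ ⌊z i⌋ = ⌊y i⌋ + 1 ∨ ⌊y i⌋ = ⌊z i⌋ + 1 := by omega
  simp only [torusProj]
  rcases h4 with h | h | h
  · simp [h]
  · simp [h]
  · simp [h]

variable {M : ℕ} [NeZero M]

lemma abs_comp_torusProj_le (f : (Fin d → ZMod M) → ℝ) (z : EuclideanSpace ℝ (Fin d)) :
    |(f ∘ torusProj M) z| ≤ ∑ x, |f x| :=
  Finset.single_le_sum (f := fun x => |f x|) (fun _ _ => abs_nonneg _) (Finset.mem_univ _)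

lemma integrable_mollify_comp_torusProj (ν : Measure (EuclideanSpace ℝ (Fin d)))
    [IsFiniteMeasure ν] (N : ℝ) (f : (Fin d → ZMod M) → ℝ) :
    Integrable (fun y => mollify (f ∘ torusProj M) (N • y)) ν :=
  integrable_of_abs_le ((contDiff_mollify (measurable_comp_torusProj f)
    (abs_comp_torusProj_le f)).continuous.comp (by fun_prop))
    fun _ => abs_mollify_le (abs_comp_torusProj_le f) _

/-- The image of `ν`, rescaled by `N` and smoothed, on the discrete torus, as a functional. -/
noncomputable def torusFunctional (M : ℕ) [NeZero M] (ν : Measure (EuclideanSpace ℝ (Fin d)))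
    [IsFiniteMeasure ν] (N : ℝ) : ((Fin d → ZMod M) → ℝ) →ₗ[ℝ] ℝ where
  toFun f := ∫ y, mollify (f ∘ torusProj M) (N • y) ∂ν
  map_add' f g := by
    rw [← integral_add (integrable_mollify_comp_torusProj ν N f)
      (integrable_mollify_comp_torusProj ν N g)]
    refine integral_congr_ae (Filter.Eventually.of_forall fun y => ?_)
    exact mollify_add (measurable_comp_torusProj f) (measurable_comp_torusProj g)
      (abs_comp_torusProj_le f) (abs_comp_torusProj_le g) _
  map_smul' c f := by
    rw [RingHom.id_apply, smul_eq_mul, ← integral_const_mul]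
    exact integral_congr_ae (Filter.Eventually.of_forall fun y =>
      mollify_smul (f ∘ torusProj M) c (N • y))

lemma torusFunctional_apply (ν : Measure (EuclideanSpace ℝ (Fin d))) [IsFiniteMeasure ν] (N : ℝ)
    (f : (Fin d → ZMod M) → ℝ) :
    torusFunctional M ν N f = ∫ y, mollify (f ∘ torusProj M) (N • y) ∂ν := rfl

lemma torusFunctional_const (ν : Measure (EuclideanSpace ℝ (Fin d))) [IsFiniteMeasure ν] (N : ℝ) :
    torusFunctional M ν N (fun _ => 1) = ν.real Set.univ := by
  rw [torusFunctional_apply, Function.comp_def]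
  simp [mollify_const]

lemma torusFunctional_nonneg (ν : Measure (EuclideanSpace ℝ (Fin d))) [IsFiniteMeasure ν] (N : ℝ)
    {f : (Fin d → ZMod M) → ℝ} (hf : ∀ x, 0 ≤ f x) : 0 ≤ torusFunctional M ν N f :=
  integral_nonneg fun _ => mollify_nonneg (fun _ => hf _) _

/-- The constant relating the oscillation of a function to the gradient of its mollification. -/
noncomputable def gradConst (d : ℕ) : ℝ :=
  (∫ t, ‖fderiv ℝ (unitBump (EuclideanSpace ℝ (Fin d))) t‖) * d

lemma gradConst_nonneg (d : ℕ) : 0 ≤ gradConst d :=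
  mul_nonneg (integral_nonneg fun _ => norm_nonneg _) (Nat.cast_nonneg d)

omit [NeZero M] in
lemma mollify_comp_torusProj_sub_single (f : (Fin d → ZMod M) → ℝ) (i : Fin d)
    (z : EuclideanSpace ℝ (Fin d)) :
    mollify ((fun x => f (x - Pi.single i 1)) ∘ torusProj M) z =
      mollify (f ∘ torusProj M) (z - EuclideanSpace.single i 1) := by
  simp only [mollify, Function.comp_apply]
  refine integral_congr_ae (Filter.Eventually.of_forall fun t => ?_)
  simp only
  rw [sub_right_comm, torusProj_sub_single]

lemma abs_torusFunctional_sub_le {ν : Measure (EuclideanSpace ℝ (Fin d))} [IsFiniteMeasure ν]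
    {i : Fin d} {C ε : ℝ} (hν : DerivBound ν (EuclideanSpace.single i 1) C ε)
    {N : ℝ} (hN : 0 < N) {f : (Fin d → ZMod M) → ℝ} {a b : ℝ} (ha : ∀ x, |f x| ≤ a)
    (hb : ∀ l x, |f x - f (x - Pi.single l 1)| ≤ b) :
    |torusFunctional M ν N (fun x => f (x - Pi.single i 1)) - torusFunctional M ν N f| ≤
      C / N * a + ε * gradConst d * b := by
  set g : EuclideanSpace ℝ (Fin d) → ℝ := fun y => mollify (f ∘ torusProj M) (N • y) with hg
  have hm : ContDiff ℝ 1 (mollify (f ∘ torusProj M)) :=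
    contDiff_mollify (measurable_comp_torusProj f) (abs_comp_torusProj_le f)
  have hg1 : ContDiff ℝ 1 g := hm.comp (contDiff_const_smul N)
  have hga : ∀ x, |g x| ≤ a := fun x => abs_mollify_le (fun z => ha _) _
  have hgb : ∀ x, ‖fderiv ℝ g x‖ ≤ N * (gradConst d * b) := by
    intro x
    have h1 : HasFDerivAt g ((fderiv ℝ (mollify (f ∘ torusProj M)) (N • x)).comp
        (N • ContinuousLinearMap.id ℝ _)) x :=
      ((hm.differentiable one_ne_zero) _).hasFDerivAt.comp x ((hasFDerivAt_id x).const_smul N)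
    rw [h1.fderiv, ContinuousLinearMap.comp_smul, ContinuousLinearMap.comp_id, norm_smul,
      Real.norm_of_nonneg hN.le]
    refine mul_le_mul_of_nonneg_left ?_ hN.le
    rw [gradConst, mul_assoc]
    exact norm_fderiv_mollify_le (measurable_comp_torusProj f) (fun z => ha _)
      fun z hz => abs_comp_torusProj_sub_le hb hz
  have h := hν.abs_integral_sub_le hg1 hga hgb (-N⁻¹)
  rw [torusFunctional_apply, torusFunctional_apply, ← integral_sub
    (integrable_mollify_comp_torusProj ν N _) (integrable_mollify_comp_torusProj ν N f)]
  have h2 : ∀ y, g (y + (-N⁻¹) • EuclideanSpace.single i 1) =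
      mollify ((fun x => f (x - Pi.single i 1)) ∘ torusProj M) (N • y) := by
    intro y
    rw [mollify_comp_torusProj_sub_single, hg]
    simp only [smul_add, smul_smul]
    rw [mul_neg, mul_inv_cancel₀ hN.ne', neg_one_smul, sub_eq_add_neg]
  simp only [h2] at h
  refine h.trans (le_of_eq ?_)
  rw [abs_neg, abs_of_pos (inv_pos.2 hN)]
  field_simp

/-- The mass that the smoothed image of `ν` on the discrete torus gives to a point. -/
noncomputable def torusMass (M : ℕ) [NeZero M] (ν : Measure (EuclideanSpace ℝ (Fin d)))
    [IsFiniteMeasure ν] (N : ℝ) (x : Fin d → ZMod M) : ℝ :=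
  torusFunctional M ν N (Pi.single x 1)

lemma torusMass_nonneg (ν : Measure (EuclideanSpace ℝ (Fin d))) [IsFiniteMeasure ν] (N : ℝ) :
    0 ≤ torusMass M ν N := fun _ =>
  torusFunctional_nonneg ν N (Pi.single_nonneg.2 zero_le_one : (0 : (Fin d → ZMod M) → ℝ) ≤ _)

lemma sum_mul_torusMass (ν : Measure (EuclideanSpace ℝ (Fin d))) [IsFiniteMeasure ν] (N : ℝ)
    (f : (Fin d → ZMod M) → ℝ) : ∑ x, f x * torusMass M ν N x = torusFunctional M ν N f :=
  (linearMap_eq_sum_single (torusFunctional M ν N) f).symm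

lemma sum_torusMass (ν : Measure (EuclideanSpace ℝ (Fin d))) [IsFiniteMeasure ν] (N : ℝ) :
    ∑ x, torusMass M ν N x = ν.real Set.univ := by
  rw [← torusFunctional_const (M := M) ν N, ← sum_mul_torusMass]
  simp

lemma exists_fwdDif_torusMass_eq {ν : Measure (EuclideanSpace ℝ (Fin d))} [IsFiniteMeasure ν]
    {C ε : ℝ} (hν : ∀ i, DerivBound ν (EuclideanSpace.single i 1) C ε) (hC : 0 ≤ C)
    (hε : 0 ≤ ε) {N : ℝ} (hN : 0 < N) :
    ∃ (σ : Fin d → (Fin d → ZMod M) → ℝ) (R : Fin d → Fin d → (Fin d → ZMod M) → ℝ),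
      (∀ i, fwdDif (Pi.single i 1) (torusMass M ν N) =
        σ i + ∑ l, fwdDif (Pi.single l 1) (R i l)) ∧
      (∀ i, ∑ x, |σ i x| ≤ C / N) ∧ ∀ i, ∑ x, ∑ l, |R i l x| ≤ ε * gradConst d := by
  have H : ∀ i, ∃ σ, ∃ R : Fin d → (Fin d → ZMod M) → ℝ,
      fwdDif (Pi.single i 1) (torusMass M ν N) = σ + ∑ l, fwdDif (Pi.single l 1) (R l) ∧
      ∑ x, |σ x| ≤ C / N ∧ ∑ x, ∑ l, |R l x| ≤ ε * gradConst d := by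
    intro i
    refine exists_eq_add_sum_fwdDif (fun l : Fin d => (Pi.single l 1 : Fin d → ZMod M)) _
      (div_nonneg hC hN.le) (mul_nonneg hε (gradConst_nonneg d)) fun f a b ha _ hb => ?_
    have h1 : ∑ x, f x * fwdDif (Pi.single i 1) (torusMass M ν N) x =
        torusFunctional M ν N (fun x => f (x - Pi.single i 1)) - torusFunctional M ν N f := by
      simp only [fwdDif_apply, mul_sub, Finset.sum_sub_distrib, sum_mul_torusMass]
      congr 1
      rw [← sum_mul_torusMass]
      exact Fintype.sum_equiv (Equiv.addRight (Pi.single i 1)) _ _ fun _ => by simp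
    rw [h1]
    exact (le_abs_self _).trans (abs_torusFunctional_sub_le (hν i) hN ha hb)
  choose σ R h1 h2 h3 using H
  exact ⟨σ, R, h1, h2, h3⟩

end Torus

section Cells

open scoped ENNReal

variable {d : ℕ}

lemma measurableSet_cell (k : Fin d → ℤ) :
    MeasurableSet {z : EuclideanSpace ℝ (Fin d) | ∀ i, ⌊z i⌋ = k i} := by
  simp only [Set.ofPred_forall]
  exact MeasurableSet.iInter fun i =>
    (Int.measurable_floor.comp (by fun_prop : Measurable fun z : EuclideanSpace ℝ (Fin d) => z i))
      (measurableSet_singleton (k i))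

lemma volume_cell (k : Fin d → ℤ) :
    volume {z : EuclideanSpace ℝ (Fin d) | ∀ i, ⌊z i⌋ = k i} = 1 := by
  have h := (PiLp.volume_preserving_ofLp (Fin d)).measure_preimage
    (s := Set.pi Set.univ fun i => Set.Ico (k i : ℝ) (k i + 1))
    (MeasurableSet.univ_pi fun _ => measurableSet_Ico).nullMeasurableSet
  rw [Real.volume_pi_Ico] at h
  simp only [add_sub_cancel_left, ENNReal.ofReal_one, Finset.prod_const_one] at h
  rw [← h]
  congr 1
  ext z
  simp [Int.floor_eq_iff]

lemma norm_sub_le_of_floor_eq {z w : EuclideanSpace ℝ (Fin d)} (h : ∀ i, ⌊z i⌋ = ⌊w i⌋) :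
    ‖z - w‖ ≤ √d := by
  rw [EuclideanSpace.norm_eq]
  refine Real.sqrt_le_sqrt ?_
  have h1 : ∀ i ∈ Finset.univ, ‖(z - w) i‖ ^ 2 ≤ 1 := fun i _ => by
    rw [sq_le_one_iff₀ (norm_nonneg _)]
    exact (Int.abs_sub_lt_one_of_floor_eq_floor (h i)).le
  simpa using Finset.sum_le_sum h1

variable {M : ℕ} [NeZero M]

omit [NeZero M] in
lemma card_cells_le {K : Set (EuclideanSpace ℝ (Fin d))} {N : ℝ} (hN : 0 < N)
    (X : Finset (Fin d → ZMod M))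
    (hX : ∀ x ∈ X, ∃ y ∈ K, ∃ z, ‖z - N • y‖ ≤ 1 ∧ torusProj M z = x) :
    (X.card : ℝ≥0∞) * ENNReal.ofReal ((N ^ d)⁻¹) ≤
      volume (Metric.cthickening ((√d + 1) / N) K) := by
  choose! y hyK z hz hzx using hX
  let S : (Fin d → ZMod M) → Set (EuclideanSpace ℝ (Fin d)) := fun x =>
    (N • ·) ⁻¹' {w | ∀ i, ⌊w i⌋ = ⌊(z x) i⌋}
  have hS : ∀ x, volume (S x) = ENNReal.ofReal ((N ^ d)⁻¹) := fun x => by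
    rw [Measure.addHaar_preimage_smul _ hN.ne', volume_cell fun i => ⌊(z x) i⌋, mul_one,
      finrank_euclideanSpace_fin, abs_of_pos (by positivity)]
  have hSm : ∀ x, MeasurableSet (S x) := fun x =>
    (measurable_const_smul N) (measurableSet_cell fun i => ⌊(z x) i⌋)
  have hdisj : (X : Set (Fin d → ZMod M)).PairwiseDisjoint S := by
    intro x hx x' hx' hne
    refine Set.disjoint_left.2 fun w hw hw' => hne ?_
    rw [← hzx x hx, ← hzx x' hx']
    ext i
    simp only [torusProj]
    rw [← hw i, ← hw' i]
  calc (X.card : ℝ≥0∞) * ENNReal.ofReal ((N ^ d)⁻¹) = ∑ x ∈ X, volume (S x) := by simp [hS]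
    _ = volume (⋃ x ∈ X, S x) := (measure_biUnion_finset hdisj fun x _ => hSm x).symm
    _ ≤ _ := by
      refine measure_mono (Set.iUnion₂_subset fun x hx w hw => ?_)
      refine Metric.mem_cthickening_of_dist_le w (y x) _ K (hyK x hx) ?_
      have h1 : ‖N • w - N • y x‖ ≤ √d + 1 :=
        (norm_sub_le_norm_sub_add_norm_sub _ (z x) _).trans
          (add_le_add (norm_sub_le_of_floor_eq hw) (hz x hx))
      rw [← smul_sub, norm_smul, Real.norm_of_nonneg hN.le] at h1
      rw [dist_eq_norm, le_div_iff₀ hN]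
      linarith

lemma sum_torusMass_of_cells {ν : Measure (EuclideanSpace ℝ (Fin d))} [IsFiniteMeasure ν]
    {K : Set (EuclideanSpace ℝ (Fin d))} (hK : ν Kᶜ = 0) (N : ℝ) (X : Finset (Fin d → ZMod M))
    (hX : ∀ y ∈ K, ∀ z, ‖z - N • y‖ ≤ 1 → torusProj M z ∈ X) :
    ∑ x ∈ X, torusMass M ν N x = ν.real Set.univ := by
  rw [← sum_torusMass (M := M) ν N]
  refine Finset.sum_subset (Finset.subset_univ X) fun x _ hx => ?_
  rw [torusMass, torusFunctional_apply]
  refine integral_eq_zero_of_ae ?_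
  have hK' : ∀ᵐ y ∂ν, y ∈ K := hK
  filter_upwards [hK'] with y hy
  refine mollify_eq_zero fun z hz => ?_
  have : torusProj M z ≠ x := fun h => hx (h ▸ hX y hy z hz)
  simp [this]

end Cells

section Vanish

variable {d : ℕ}

lemma real_univ_le_of_derivBound {ν : Measure (EuclideanSpace ℝ (Fin d))} [IsFiniteMeasure ν]
    {K : Set (EuclideanSpace ℝ (Fin d))} (hKc : IsCompact K) (hK : ν Kᶜ = 0) {C ε : ℝ}
    (hν : ∀ i, DerivBound ν (EuclideanSpace.single i 1) C ε) (hC : 0 ≤ C) (hε : 0 < ε)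
    {A B : ℝ} (hA : A = d * (gradConst d + 1) * ε) (hAB : A ≤ B) (hB : 0 < B) {k : ℕ} (hk : 0 < k) :
    ν.real Set.univ ≤ √(A / B * (ν.real Set.univ) ^ 2 + 2 * (d + 1) ^ 3 * A ^ 2) +
      √(Real.exp 1 * √(d + 1) * (√(d + 1) * ((C + 1) / ε)) ^ d *
        ((ν.real Set.univ) ^ 2 + 2 * (d + 1) ^ 3 * (A * B)) *
        volume.real (Metric.cthickening
          ((√d + 1) / (√k * (√(d + 1) * ((C + 1) / ε)))) K)) := by
  classical
  set s : ℝ := √(d + 1) * ((C + 1) / ε) with hs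
  set N : ℝ := √k * s with hN
  have hk' : (0 : ℝ) < √k := Real.sqrt_pos.2 (by exact_mod_cast hk)
  have hd' : (0 : ℝ) < √(d + 1) := Real.sqrt_pos.2 (by positivity)
  have hs0 : 0 < s := by positivity
  have hN0 : 0 < N := by positivity
  set m := ν.real Set.univ with hm
  set n : ℕ := (d + 1) * k with hn
  let M : ℕ := n + 1
  obtain ⟨σ, R, hu, hσ, hR⟩ := exists_fwdDif_torusMass_eq (M := M) hν hC hε.le hN0
  let X : Finset (Fin d → ZMod M) :=
    {x | ∃ y ∈ K, ∃ z : EuclideanSpace ℝ (Fin d), ‖z - N • y‖ ≤ 1 ∧ torusProj M z = x}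
  set κ : ℝ := Real.exp 1 * √(d + 1) / √k ^ d with hκ
  have hκ0 : 0 < κ := by positivity
  have hbound : ∑ x, ∑ i, ∑ l, |R i l x| + √n * ∑ x, ∑ i, |σ i x| ≤ A := by
    have h1 : ∑ x, ∑ i, ∑ l, |R i l x| ≤ d * (ε * gradConst d) := by
      rw [Finset.sum_comm]
      simpa using Finset.sum_le_sum fun i (_ : i ∈ Finset.univ) => hR i
    have h2 : ∑ x, ∑ i, |σ i x| ≤ d * (C / N) := by
      rw [Finset.sum_comm]
      simpa using Finset.sum_le_sum fun i (_ : i ∈ Finset.univ) => hσ i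
    have h3 : √(n : ℝ) * (C / N) ≤ ε := by
      have : √(n : ℝ) = √(d + 1) * √k := by
        rw [hn]; push_cast; rw [Real.sqrt_mul (by positivity)]
      rw [this, hN, hs]
      have : √((d : ℝ) + 1) * √k * (C / (√k * (√(d + 1) * ((C + 1) / ε)))) = ε * (C / (C + 1)) := by
        field_simp
      rw [this]
      exact mul_le_of_le_one_right hε.le (div_le_one_of_le₀ (by linarith) (by linarith))
    calc _ ≤ d * (ε * gradConst d) + √n * (d * (C / N)) := by gcongr
      _ = d * (ε * gradConst d) + d * (√n * (C / N)) := by ring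
      _ ≤ d * (ε * gradConst d) + d * ε := by gcongr
      _ = A := by rw [hA]; ring
  have hwalk : ∀ f : (Fin d → ZMod M) → ℝ, 0 ≤ f → ∀ x,
      (walkAvg (fun i : Fin d => (Pi.single i 1 : Fin d → ZMod M)) ^ n) f x ≤
        κ * ∑ y, f y := by
    intro f hf x
    have := walkAvg_pow_le_torus (ι := Fin d) (M := M) hk (by simp [M, hn]) f hf x
    simpa using this
  have main := sum_le_of_fwdDif_eq (fun i : Fin d => (Pi.single i 1 : Fin d → ZMod M)) n hκ0
    hwalk (torusMass_nonneg ν N) hu hbound hAB hB X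
  rw [sum_torusMass_of_cells hK N X fun y hy z hz => by
    simp only [X, Finset.mem_filter, Finset.mem_univ, true_and]
    exact ⟨y, hy, z, hz, rfl⟩, sum_torusMass, ← hm, Fintype.card_fin] at main
  refine main.trans (add_le_add le_rfl (Real.sqrt_le_sqrt ?_))
  have hX := card_cells_le (K := K) hN0 X fun x hx => by
    simpa only [X, Finset.mem_filter, Finset.mem_univ, true_and] using hx
  have hfin : volume (Metric.cthickening ((√d + 1) / N) K) ≠ ⊤ :=
    hKc.isBounded.cthickening.measure_lt_top.ne
  have hX' := ENNReal.toReal_mono hfin hX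
  rw [ENNReal.toReal_mul, ENNReal.toReal_natCast, ENNReal.toReal_ofReal (by positivity),
    ← div_eq_mul_inv, div_le_iff₀ (by positivity)] at hX'
  have hA0 : 0 ≤ A := by
    rw [hA]; have := gradConst_nonneg d; positivity
  calc (X.card : ℝ) * (κ * (m ^ 2 + 2 * (d + 1) ^ 3 * (A * B)))
      ≤ (volume (Metric.cthickening ((√d + 1) / N) K)).toReal * N ^ d *
          (κ * (m ^ 2 + 2 * (d + 1) ^ 3 * (A * B))) := by gcongr
    _ = _ := by
      rw [hκ, hN, mul_pow, Measure.real]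
      field_simp

theorem measure_univ_eq_zero_of_derivBound {ν : Measure (EuclideanSpace ℝ (Fin d))}
    [IsFiniteMeasure ν] {K : Set (EuclideanSpace ℝ (Fin d))} (hKc : IsCompact K)
    (hKv : volume K = 0) (hK : ν Kᶜ = 0)
    (hν : ∀ v : EuclideanSpace ℝ (Fin d), ∀ ε > 0, ∃ C, 0 ≤ C ∧ DerivBound ν v C ε) :
    ν Set.univ = 0 := by
  set m := ν.real Set.univ with hm
  have hm0 : 0 ≤ m := measureReal_nonneg
  set c := d * (gradConst d + 1) with hc
  have hc0 : 0 ≤ c := by have := gradConst_nonneg d; positivity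
  have step : ∀ ε > 0, m ≤ √(c + 2 * (d + 1) ^ 3 * c ^ 2) * ε := by
    intro ε hε
    have hC : ∃ C, 0 ≤ C ∧ ∀ i : Fin d, DerivBound ν (EuclideanSpace.single i 1) C ε := by
      choose C hC0 hC using fun i : Fin d => hν (EuclideanSpace.single i 1) ε hε
      refine ⟨∑ i, C i, Finset.sum_nonneg fun i _ => hC0 i, fun i g a b hg ha hb => ?_⟩
      have h0 : 0 ≤ a := (abs_nonneg _).trans (ha 0)
      refine (hC i g a b hg ha hb).trans ?_
      gcongr
      exact Finset.single_le_sum (fun i _ => hC0 i) (Finset.mem_univ i)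
    obtain ⟨C, hC0, hC⟩ := hC
    set A := c * ε with hA
    have hA0 : 0 ≤ A := by positivity
    set B := (m ^ 2 + 1) / ε + A with hB
    have hB0 : 0 < B := by positivity
    have hAB : A ≤ B := by rw [hB]; linarith [show 0 ≤ (m ^ 2 + 1) / ε by positivity]
    set s : ℝ := √(d + 1) * ((C + 1) / ε) with hs
    have hs0 : 0 < s := by positivity
    have hlim : Filter.Tendsto (fun k : ℕ => √(A / B * m ^ 2 + 2 * (d + 1) ^ 3 * A ^ 2) +
        √(Real.exp 1 * √(d + 1) * s ^ d * (m ^ 2 + 2 * (d + 1) ^ 3 * (A * B)) *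
          volume.real (Metric.cthickening ((√d + 1) / (√k * s)) K))) Filter.atTop
        (nhds (√(A / B * m ^ 2 + 2 * (d + 1) ^ 3 * A ^ 2) +
          √(Real.exp 1 * √(d + 1) * s ^ d * (m ^ 2 + 2 * (d + 1) ^ 3 * (A * B)) * 0))) := by
      refine tendsto_const_nhds.add ((Filter.Tendsto.const_mul _ ?_).sqrt)
      have h1 : Filter.Tendsto (fun k : ℕ => (√d + 1) / (√k * s)) Filter.atTop (nhds 0) := by
        refine Filter.Tendsto.const_div_atTop ?_ _
        exact (Real.tendsto_sqrt_atTop.comp tendsto_natCast_atTop_atTop).atTop_mul_const hs0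
      have h2 := (tendsto_measure_cthickening_of_isCompact (μ := volume) hKc).comp h1
      rw [hKv] at h2
      simpa [Function.comp_def, Measure.real] using
        (ENNReal.tendsto_toReal ENNReal.zero_ne_top).comp h2
    have hle := ge_of_tendsto hlim (Filter.eventually_atTop.2 ⟨1, fun k hk =>
      real_univ_le_of_derivBound hKc hK hC hC0 hε hA hAB hB0 hk⟩)
    rw [mul_zero, Real.sqrt_zero, add_zero] at hle
    refine hle.trans ?_
    rw [← Real.sqrt_sq hε.le, ← Real.sqrt_mul (by positivity)]
    refine Real.sqrt_le_sqrt ?_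
    have : A / B * m ^ 2 ≤ A * ε := by
      rw [div_mul_eq_mul_div, div_le_iff₀ hB0, mul_assoc A ε B]
      refine mul_le_mul_of_nonneg_left ?_ hA0
      have : ε * B = m ^ 2 + 1 + ε * A := by rw [hB]; field_simp
      rw [this]
      nlinarith [mul_nonneg hε.le hA0]
    rw [hA] at this ⊢
    nlinarith
  have hm' : m ≤ 0 := by
    refine le_of_forall_pos_le_add fun δ hδ => ?_
    set P := √(c + 2 * (d + 1) ^ 3 * c ^ 2)
    have hP : 0 ≤ P := Real.sqrt_nonneg _
    refine (step (δ / (P + 1)) (by positivity)).trans ?_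
    rw [zero_add, mul_div_assoc', div_le_iff₀ (by positivity)]
    nlinarith
  exact (measureReal_eq_zero_iff (measure_ne_top _ _)).1 (le_antisymm hm' hm0)

end Vanish

section Mazur

lemma exists_mem_closure_of_antitone {H : Type*} [NormedAddCommGroup H] [InnerProductSpace ℝ H]
    [CompleteSpace H] {S : ℕ → Set H} (hanti : Antitone S) (hconv : ∀ n, Convex ℝ (S n))
    (hne : ∀ n, (S n).Nonempty) {b : ℝ} (hb : ∀ n, ∀ w ∈ S n, ‖w‖ ≤ b) :
    ∃ ω, ∀ n, ω ∈ closure (S n) := by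
  have hmin : ∀ n, ∃ p ∈ closure (S n), ∀ w ∈ closure (S n), ‖p‖ ≤ ‖w‖ := by
    intro n
    obtain ⟨p, hp, hp'⟩ := exists_norm_eq_iInf_of_complete_convex (hne n).closure
      isClosed_closure.isComplete (hconv n).closure (0 : H)
    refine ⟨p, hp, fun w hw => ?_⟩
    simp only [zero_sub, norm_neg] at hp'
    rw [hp']
    exact ciInf_le ⟨0, by rintro _ ⟨x, rfl⟩; exact norm_nonneg _⟩ (⟨w, hw⟩ : closure (S n))
  choose p hp hpmin using hmin
  have hmem : ∀ n k, n ≤ k → p k ∈ closure (S n) := fun n k hnk =>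
    closure_mono (hanti hnk) (hp k)
  have hmono : Monotone fun n => ‖p n‖ := fun n k hnk => hpmin n _ (hmem n k hnk)
  have hbd : ∀ n, ‖p n‖ ≤ b := fun n =>
    closure_minimal (fun w hw => by simpa using hb n w hw) Metric.isClosed_closedBall (hp n)
      |> fun h : p n ∈ Metric.closedBall 0 b => by simpa using h
  have hlim := tendsto_atTop_ciSup hmono ⟨b, by rintro _ ⟨n, rfl⟩; exact hbd n⟩
  set L := ⨆ n, ‖p n‖
  have hle : ∀ n, ‖p n‖ ≤ L := fun n => hmono.ge_of_tendsto hlim n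
  have hdist : ∀ n k, n ≤ k → ‖p k - p n‖ ≤ √(2 * (L ^ 2 - ‖p n‖ ^ 2)) := by
    intro n k hnk
    apply Real.le_sqrt_of_sq_le
    have h1 := parallelogram_law_with_norm ℝ (p k) (p n)
    have h2 : (1 / 2 : ℝ) • p k + (1 / 2 : ℝ) • p n ∈ closure (S n) :=
      (hconv n).closure (hmem n k hnk) (hp n) (by norm_num) (by norm_num) (by norm_num)
    have h3 := hpmin n _ h2
    rw [← smul_add, norm_smul, Real.norm_of_nonneg (by norm_num)] at h3
    have h4 : (2 * ‖p n‖) ^ 2 ≤ ‖p k + p n‖ ^ 2 :=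
      pow_le_pow_left₀ (by positivity) (by linarith) 2
    have h5 : ‖p k‖ ^ 2 ≤ L ^ 2 := pow_le_pow_left₀ (norm_nonneg _) (hle k) 2
    nlinarith
  have hcau : CauchySeq p := by
    refine cauchySeq_of_le_tendsto_0' (fun n => √(2 * (L ^ 2 - ‖p n‖ ^ 2))) (fun n k hnk => ?_) ?_
    · rw [dist_comm, dist_eq_norm]; exact hdist n k hnk
    · have : Filter.Tendsto (fun n => √(2 * (L ^ 2 - ‖p n‖ ^ 2))) Filter.atTop
          (nhds √(2 * (L ^ 2 - L ^ 2))) :=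
        (((hlim.pow 2).const_sub _).const_mul 2).sqrt
      simpa using this
  obtain ⟨ω, hω⟩ := cauchySeq_tendsto_of_complete hcau
  exact ⟨ω, fun n => isClosed_closure.mem_of_tendsto hω
    (Filter.eventually_atTop.2 ⟨n, fun k hk => hmem n k hk⟩)⟩

end Mazur

section Closability

variable {E : Type*} [NormedAddCommGroup E] [InnerProductSpace ℝ E] [FiniteDimensional ℝ E]
  [MeasurableSpace E] [BorelSpace E]

/-- `C¹` functions bounded by `a` and with gradient bounded by `1`, whose mean derivative in
direction `v` is at least `ε`. -/
structure IsSteep (ν : Measure E) (v : E) (ε a : ℝ) (h : E → ℝ) : Prop where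
  contDiff : ContDiff ℝ 1 h
  abs_le : ∀ x, |h x| ≤ a
  norm_fderiv_le : ∀ x, ‖fderiv ℝ h x‖ ≤ 1
  le_integral : ε ≤ ∫ x, fderiv ℝ h x v ∂ν

omit [FiniteDimensional ℝ E] [BorelSpace E] in
lemma IsSteep.mono {ν : Measure E} {v : E} {ε a a' : ℝ} (ha : a ≤ a') {h : E → ℝ}
    (hh : IsSteep ν v ε a h) : IsSteep ν v ε a' h :=
  ⟨hh.1, fun x => (hh.2 x).trans ha, hh.3, hh.4⟩

omit [FiniteDimensional ℝ E] in
lemma integrable_fderiv_apply {ν : Measure E} [IsFiniteMeasure ν] {g : E → ℝ}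
    (hg : ContDiff ℝ 1 g) {b : ℝ} (hb : ∀ x, ‖fderiv ℝ g x‖ ≤ b) (v : E) :
    Integrable (fun x => fderiv ℝ g x v) ν :=
  integrable_of_abs_le ((hg.continuous_fderiv one_ne_zero).clm_apply continuous_const)
    fun x => (ContinuousLinearMap.le_opNorm _ _).trans
      (mul_le_mul_of_nonneg_right (hb x) (norm_nonneg v))

omit [FiniteDimensional ℝ E] [MeasurableSpace E] [BorelSpace E] in
lemma fderiv_combo {g h : E → ℝ} (hg : ContDiff ℝ 1 g) (hh : ContDiff ℝ 1 h) (s t : ℝ) (x : E) :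
    fderiv ℝ (fun y => s * g y + t * h y) x = s • fderiv ℝ g x + t • fderiv ℝ h x :=
  (((hg.differentiable one_ne_zero x).hasFDerivAt.const_mul s).add
    ((hh.differentiable one_ne_zero x).hasFDerivAt.const_mul t)).fderiv

omit [FiniteDimensional ℝ E] in
lemma IsSteep.combo {ν : Measure E} [IsFiniteMeasure ν] {v : E} {ε a : ℝ} {g h : E → ℝ}
    (hg : IsSteep ν v ε a g) (hh : IsSteep ν v ε a h) {s t : ℝ} (hs : 0 ≤ s) (ht : 0 ≤ t)
    (hst : s + t = 1) : IsSteep ν v ε a fun x => s * g x + t * h x := by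
  refine ⟨(contDiff_const.mul hg.1).add (contDiff_const.mul hh.1), fun x => ?_, fun x => ?_, ?_⟩
  · calc |s * g x + t * h x| ≤ |s * g x| + |t * h x| := abs_add_le _ _
      _ = s * |g x| + t * |h x| := by rw [abs_mul, abs_mul, abs_of_nonneg hs, abs_of_nonneg ht]
      _ ≤ s * a + t * a := by gcongr; exacts [hg.2 x, hh.2 x]
      _ = a := by rw [← add_mul, hst, one_mul]
  · rw [fderiv_combo hg.1 hh.1]
    calc ‖s • fderiv ℝ g x + t • fderiv ℝ h x‖ ≤ ‖s • fderiv ℝ g x‖ + ‖t • fderiv ℝ h x‖ :=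
          norm_add_le _ _
      _ = s * ‖fderiv ℝ g x‖ + t * ‖fderiv ℝ h x‖ := by
          rw [norm_smul, norm_smul, Real.norm_of_nonneg hs, Real.norm_of_nonneg ht]
      _ ≤ s * 1 + t * 1 := by gcongr; exacts [hg.3 x, hh.3 x]
      _ = 1 := by linarith
  · simp only [fderiv_combo hg.1 hh.1, add_apply,
      smul_apply, smul_eq_mul]
    rw [integral_add ((integrable_fderiv_apply hg.1 hg.3 v).const_mul s)
      ((integrable_fderiv_apply hh.1 hh.3 v).const_mul t), integral_const_mul, integral_const_mul]
    calc ε = s * ε + t * ε := by rw [← add_mul, hst, one_mul]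
      _ ≤ _ := by gcongr; exacts [hg.4, hh.4]

omit [FiniteDimensional ℝ E] [BorelSpace E] in
lemma exists_isSteep {ν : Measure E} [IsFiniteMeasure ν] {v : E} {ε : ℝ}
    (hε : 0 < ε) (hν : ∀ C, 0 ≤ C → ¬ DerivBound ν v C ε) (n : ℕ) :
    ∃ h, IsSteep ν v ε (1 / (n + 1)) h := by
  set T := ‖v‖ * ν.real Set.univ with hT
  have hT0 : 0 ≤ T := by positivity
  have := hν ((n + 1) * T) (by positivity)
  simp only [DerivBound, not_forall, not_le] at this
  obtain ⟨g, a, b, hg, ha, hb, hlt⟩ := this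
  have ha0 : 0 ≤ a := (abs_nonneg _).trans (ha 0)
  have hle : |∫ x, fderiv ℝ g x v ∂ν| ≤ b * T := by
    refine (norm_integral_le_of_norm_le_const (Filter.Eventually.of_forall fun x =>
      (ContinuousLinearMap.le_opNorm _ _).trans
      (mul_le_mul_of_nonneg_right (hb x) (norm_nonneg v)))).trans_eq ?_
    rw [hT, mul_assoc]
  have hb0 : 0 ≤ b := (norm_nonneg _).trans (hb 0)
  have hbpos : 0 < b := by
    rcases hb0.eq_or_lt with h | h
    · rw [← h] at hlt hle
      nlinarith [show 0 ≤ (n + 1) * T * a by positivity]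
    · exact h
  have hab : (n + 1) * a < b := by
    by_contra! h
    nlinarith [mul_le_mul_of_nonneg_left h hT0, mul_pos hε hbpos]
  obtain ⟨τ, hτ, hτ'⟩ : ∃ τ : ℝ, |τ| = 1 ∧
      |∫ x, fderiv ℝ g x v ∂ν| = τ * ∫ x, fderiv ℝ g x v ∂ν := by
    rcases abs_cases (∫ x, fderiv ℝ g x v ∂ν) with h | h
    · exact ⟨1, by simp, by rw [h.1, one_mul]⟩
    · exact ⟨-1, by simp, by rw [h.1, neg_one_mul]⟩
  have hτb : |τ / b| = 1 / b := by rw [abs_div, hτ, abs_of_pos hbpos]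
  have hd : ∀ x, fderiv ℝ (fun y => τ / b * g y) x = (τ / b) • fderiv ℝ g x := fun x =>
    ((hg.differentiable one_ne_zero x).hasFDerivAt.const_mul _).fderiv
  refine ⟨fun x => τ / b * g x, contDiff_const.mul hg, fun x => ?_, fun x => ?_, ?_⟩
  · rw [abs_mul, hτb, div_mul_eq_mul_div, one_mul, div_le_div_iff₀ hbpos (by positivity)]
    nlinarith [mul_le_mul_of_nonneg_left (ha x) (show (0 : ℝ) ≤ n + 1 by positivity)]
  · rw [hd, norm_smul, Real.norm_eq_abs, hτb, div_mul_eq_mul_div, one_mul]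
    exact div_le_one_of_le₀ (hb x) hb0
  · simp only [hd, smul_apply, smul_eq_mul]
    rw [integral_const_mul, div_mul_eq_mul_div, ← hτ', le_div_iff₀ hbpos]
    nlinarith [show 0 ≤ (n + 1) * T * a by positivity]

lemma exists_tendsto_ae_fderiv {ν : Measure E} [IsFiniteMeasure ν] {v : E} {ε : ℝ}
    (hε : 0 < ε) (hν : ∀ C, 0 ≤ C → ¬ DerivBound ν v C ε) :
    ∃ (h : ℕ → E → ℝ) (ω : E → E →L[ℝ] ℝ), (∀ n : ℕ, IsSteep ν v ε (1 / (n + 1)) (h n)) ∧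
      StronglyMeasurable ω ∧
      ∀ᵐ x ∂ν, Filter.Tendsto (fun n => fderiv ℝ (h n) x) Filter.atTop (nhds (ω x)) := by
  have : CompleteSpace E := FiniteDimensional.complete ℝ E
  let D : (E →L[ℝ] ℝ) → E := (InnerProductSpace.toDual ℝ E).symm
  have hDc : Continuous D := (InnerProductSpace.toDual ℝ E).symm.continuous
  have hDn : ∀ L, ‖D L‖ = ‖L‖ := (InnerProductSpace.toDual ℝ E).symm.norm_map
  let S : ℕ → Set (Lp E 2 ν) := fun n =>
    {w | ∃ h, IsSteep ν v ε (1 / (n + 1)) h ∧ w =ᵐ[ν] fun x => D (fderiv ℝ h x)}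
  have hne : ∀ n, (S n).Nonempty := fun n => by
    obtain ⟨h, hh⟩ := exists_isSteep hε hν n
    have hm : MemLp (fun x => D (fderiv ℝ h x)) 2 ν :=
      MemLp.of_bound (hDc.comp (hh.1.continuous_fderiv one_ne_zero)).aestronglyMeasurable 1
        (Filter.Eventually.of_forall fun x => (hDn _).trans_le (hh.3 x))
    exact ⟨hm.toLp, h, hh, hm.coeFn_toLp⟩
  have hanti : Antitone S := fun n k hnk w ⟨h, hh, hw⟩ =>
    ⟨h, hh.mono (Nat.one_div_le_one_div hnk), hw⟩
  have hconv : ∀ n, Convex ℝ (S n) := by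
    rintro n w₁ ⟨g, hg, hw₁⟩ w₂ ⟨h, hh, hw₂⟩ s t hs ht hst
    refine ⟨_, hg.combo hh hs ht hst, ?_⟩
    filter_upwards [Lp.coeFn_add (s • w₁) (t • w₂), Lp.coeFn_smul s w₁, Lp.coeFn_smul t w₂,
      hw₁, hw₂] with x h1 h2 h3 h4 h5
    rw [h1, Pi.add_apply, h2, h3, Pi.smul_apply, Pi.smul_apply, h4, h5, fderiv_combo hg.1 hh.1]
    simp [D]
  have hb : ∀ n, ∀ w ∈ S n, ‖w‖ ≤ (measureUnivNNReal ν : ℝ) ^ (2 : ENNReal).toReal⁻¹ * 1 := by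
    rintro n w ⟨h, hh, hw⟩
    refine Lp.norm_le_of_ae_bound zero_le_one ?_
    filter_upwards [hw] with x hx
    rw [hx, hDn]
    exact hh.3 x
  obtain ⟨ω, hω⟩ := exists_mem_closure_of_antitone hanti hconv hne hb
  have hex : ∀ n : ℕ, ∃ w ∈ S n, dist ω w < 1 / ((n : ℝ) + 1) := fun n =>
    Metric.mem_closure_iff.1 (hω n) _ (by positivity)
  choose w hwS hwd using hex
  choose h hh hwh using hwS
  have hw : Filter.Tendsto w Filter.atTop (nhds ω) :=
    tendsto_iff_dist_tendsto_zero.2 (squeeze_zero (fun _ => dist_nonneg)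
      (fun n => by rw [dist_comm]; exact (hwd n).le) tendsto_one_div_add_atTop_nhds_zero_nat)
  obtain ⟨ns, hns, hlim⟩ := (tendstoInMeasure_of_tendsto_Lp hw).exists_seq_tendsto_ae
  refine ⟨fun n => h (ns n), fun x => InnerProductSpace.toDual ℝ E (ω x), fun n =>
    (hh (ns n)).mono (Nat.one_div_le_one_div (hns.id_le n)), ?_, ?_⟩
  · exact (InnerProductSpace.toDual ℝ E).continuous.comp_stronglyMeasurable
      (Lp.stronglyMeasurable ω)
  · filter_upwards [hlim, ae_all_iff.2 hwh] with x hx hx'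
    have h1 := ((InnerProductSpace.toDual ℝ E).continuous.tendsto _).comp hx
    refine h1.congr fun n => ?_
    simp [hx', D]

lemma exists_tendstoUniformlyOn_fderiv {ν : Measure E} [IsFiniteMeasure ν] {v : E} {ε : ℝ}
    (hε : 0 < ε) (hν : ∀ C, 0 ≤ C → ¬ DerivBound ν v C ε) :
    ∃ (K : Set E) (h : ℕ → E → ℝ) (ω : E → E →L[ℝ] ℝ), IsCompact K ∧ 0 < ν K ∧
      (∀ n : ℕ, IsSteep ν v ε (1 / (n + 1)) (h n)) ∧
      TendstoUniformlyOn (fun n x => fderiv ℝ (h n) x) ω Filter.atTop K ∧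
      ∀ x ∈ K, 0 < ω x v := by
  obtain ⟨h, ω, hh, hωm, hlim⟩ := exists_tendsto_ae_fderiv hε hν
  have hInt : ε ≤ ∫ x, ω x v ∂ν := by
    refine ge_of_tendsto (tendsto_integral_of_dominated_convergence (fun _ => ‖v‖)
      (F := fun n x => fderiv ℝ (h n) x v) (fun n =>
      (integrable_fderiv_apply (hh n).1 (hh n).3 v).aestronglyMeasurable)
      (integrable_const _) (fun n => Filter.Eventually.of_forall fun x => ?_) ?_)
      (Filter.Eventually.of_forall fun n => (hh n).4)
    · simpa using (ContinuousLinearMap.le_opNorm _ v).trans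
        (mul_le_mul_of_nonneg_right ((hh n).3 x) (norm_nonneg v))
    · filter_upwards [hlim] with x hx
      exact ((ContinuousLinearMap.apply ℝ ℝ v).continuous.tendsto _).comp hx
  set s : Set E := {x | 0 < ω x v} with hs
  have hsm : MeasurableSet s := measurableSet_lt measurable_const
    ((ContinuousLinearMap.apply ℝ ℝ v).continuous.comp_stronglyMeasurable hωm).measurable
  have hspos : 0 < ν s := by
    rw [pos_iff_ne_zero]
    intro h0
    have : ∫ x, ω x v ∂ν ≤ 0 := integral_nonpos_of_ae (by
      have : ∀ᵐ x ∂ν, x ∉ s := measure_eq_zero_iff_ae_notMem.1 h0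
      filter_upwards [this] with x hx
      simpa [hs] using hx)
    linarith
  have hsr : 0 < ν.real s := ENNReal.toReal_pos hspos.ne' (measure_ne_top _ _)
  obtain ⟨t, htm, htν, htu⟩ := tendstoUniformlyOn_of_ae_tendsto'
    (fun n => ((hh n).1.continuous_fderiv one_ne_zero).stronglyMeasurable) hωm hlim
    (half_pos hsr)
  have hst : 0 < ν (s \ t) := by
    rw [pos_iff_ne_zero]
    intro h0
    have h1 : ν s ≤ ν t := by
      rw [← Set.inter_union_sdiff s t]
      refine (measure_union_le _ _).trans ?_
      rw [h0, add_zero]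
      exact measure_mono Set.inter_subset_right
    have h2 := ENNReal.toReal_mono ENNReal.ofReal_ne_top (h1.trans htν)
    rw [ENNReal.toReal_ofReal (by positivity)] at h2
    rw [Measure.real] at *
    linarith
  obtain ⟨K, hKs, hKc, hKpos⟩ := (hsm.diff htm).exists_lt_isCompact hst
  exact ⟨K, h, ω, hKc, hKpos, hh, htu.mono fun x hx => (hKs hx).2, fun x hx => (hKs hx).1⟩

end Closability

section Nondifferentiable

open Filter Topology

variable {E : Type*} [NormedAddCommGroup E] [InnerProductSpace ℝ E] [FiniteDimensional ℝ E]

lemma exists_cutoff {K U : Set E} (hK : IsCompact K) (hU : IsOpen U) (hKU : K ⊆ U) :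
    ∃ χ : E → ℝ, ContDiff ℝ 1 χ ∧ (∀ x, 0 ≤ χ x ∧ χ x ≤ 1) ∧ (∀ x ∈ K, χ x = 1) ∧
      (∀ x ∉ U, χ x = 0) ∧ ∃ D, 0 ≤ D ∧ ∀ x, ‖fderiv ℝ χ x‖ ≤ D := by
  obtain ⟨ρ, hρ⟩ := hK.isBounded.subset_ball (0 : E)
  obtain ⟨χ, hχ, hrange, hsupp, hone⟩ := exists_contMDiff_support_eq_eq_one_iff
    (n := 1) (modelWithCornersSelf ℝ E) (hU.inter Metric.isOpen_ball) hK.isClosed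
    (Set.subset_inter hKU hρ)
  have hχ' : ContDiff ℝ 1 χ := hχ.contDiff
  have hcs : HasCompactSupport χ := by
    refine HasCompactSupport.of_support_subset_isCompact (isCompact_closedBall (0 : E) ρ) ?_
    rw [hsupp]
    exact Set.inter_subset_right.trans Metric.ball_subset_closedBall
  obtain ⟨D, hD⟩ := (hχ'.continuous_fderiv one_ne_zero).bounded_above_of_compact_support
    (hcs.fderiv ℝ)
  refine ⟨χ, hχ', fun x => ?_, fun x hx => (hone x).1 hx, fun x hx => ?_, D,
    (norm_nonneg _).trans (hD 0), hD⟩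
  · exact hrange ⟨x, rfl⟩
  · by_contra h
    have : x ∈ Function.support χ := h
    rw [hsupp] at this
    exact hx this.1

omit [FiniteDimensional ℝ E] in
lemma exists_uniform_taylor {S : E → ℝ} (hS : ContDiff ℝ 1 S) {K : Set E} (hK : IsCompact K)
    (v : E) {ε : ℝ} (hε : 0 < ε) :
    ∃ r, 0 < r ∧ r < ε ∧ ∀ x ∈ K, |S (x + r • v) - S x - r * fderiv ℝ S x v| ≤ r * ε := by
  have hc : Continuous (fderiv ℝ S) := hS.continuous_fderiv one_ne_zero
  have hη : 0 < ε / (‖v‖ + 1) := by positivity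
  have hu := hK.uniformContinuousAt_of_continuousAt (fderiv ℝ S) (fun a _ => hc.continuousAt)
    (Metric.dist_mem_uniformity hη)
  obtain ⟨δ, hδ, hδ'⟩ := Metric.mem_uniformity_dist.1 hu
  set r := min (ε / 2) (δ / (2 * (‖v‖ + 1))) with hr
  have hr0 : 0 < r := lt_min (by positivity) (by positivity)
  have hrv : ‖r • v‖ < δ := by
    rw [norm_smul, Real.norm_of_nonneg hr0.le]
    calc r * ‖v‖ ≤ δ / (2 * (‖v‖ + 1)) * (‖v‖ + 1) :=
          mul_le_mul (min_le_right _ _) (by linarith) (norm_nonneg _) (by positivity)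
      _ = δ / 2 := by field_simp
      _ < δ := by linarith
  refine ⟨r, hr0, (min_le_left _ _).trans_lt (by linarith), fun x hx => ?_⟩
  have h := Convex.norm_image_sub_le_of_norm_fderiv_le' (𝕜 := ℝ) (f := S)
    (φ := fderiv ℝ S x) (s := Metric.ball x δ) (x := x) (y := x + r • v)
    (C := ε / (‖v‖ + 1)) (fun y _ => hS.differentiable one_ne_zero y) (fun y hy => by
      have := hδ' (a := x) (b := y) (by rw [dist_comm]; exact hy) hx
      rw [← dist_eq_norm, dist_comm]
      exact this.le) (convex_ball x δ) (Metric.mem_ball_self hδ)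
    (by simpa using hrv)
  rw [add_sub_cancel_left, map_smul, smul_eq_mul, norm_smul, Real.norm_of_nonneg hr0.le,
    Real.norm_eq_abs] at h
  refine h.trans ?_
  rw [div_mul_eq_mul_div, div_le_iff₀ (by positivity)]
  nlinarith [mul_pos hr0 hε, norm_nonneg v]

lemma exists_alternate {K : Set E} (hK : IsCompact K) {h : ℕ → E → ℝ} {ω : E → E →L[ℝ] ℝ}
    (hh : ∀ n, ContDiff ℝ 1 (h n)) (hh0 : ∀ n x, |h n x| ≤ 1 / (n + 1))
    (hh1 : ∀ n x, ‖fderiv ℝ (h n) x‖ ≤ 1)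
    (hω : TendstoUniformlyOn (fun n x => fderiv ℝ (h n) x) ω atTop K)
    {S : E → ℝ} (hS : ContDiff ℝ 1 S) (hS5 : ∀ x, ‖fderiv ℝ S x‖ ≤ 5)
    (hSK : ∀ x ∈ K, ‖fderiv ℝ S x‖ ≤ 2) {θ η m : ℝ} (hθ : |θ| = 1) (hη : 0 < η) (hm : 0 < m) :
    ∃ S' : E → ℝ, ContDiff ℝ 1 S' ∧ (∀ x, ‖fderiv ℝ S' x‖ ≤ 5) ∧ (∀ x, |S' x - S x| ≤ m) ∧
      ∀ x ∈ K, ‖fderiv ℝ S' x - fderiv ℝ S x - θ • ω x‖ ≤ η := by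
  have hU : IsOpen {x | ‖fderiv ℝ S x‖ < 3} :=
    isOpen_lt (hS.continuous_fderiv one_ne_zero).norm continuous_const
  obtain ⟨χ, hχ, hχ01, hχ1, hχ0, D, hD0, hD⟩ := exists_cutoff hK hU
    fun x hx => (hSK x hx).trans_lt (by norm_num)
  have hev : ∀ᶠ n : ℕ in atTop, 1 / ((n : ℝ) + 1) < min m (1 / (D + 1)) :=
    tendsto_one_div_add_atTop_nhds_zero_nat.eventually (gt_mem_nhds (by positivity))
  obtain ⟨n, hn, hnω⟩ := (hev.and (Metric.tendstoUniformlyOn_iff.1 hω η hη)).exists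
  have hhm : ∀ x, |h n x| ≤ m := fun x => (hh0 n x).trans (hn.le.trans (min_le_left _ _))
  have hhD : ∀ x, |h n x| * ‖fderiv ℝ χ x‖ ≤ 1 := fun x => by
    calc |h n x| * ‖fderiv ℝ χ x‖ ≤ 1 / (D + 1) * (D + 1) :=
          mul_le_mul ((hh0 n x).trans (hn.le.trans (min_le_right _ _))) (by linarith [hD x])
            (norm_nonneg _) (by positivity)
      _ = 1 := by field_simp
  have hd : ∀ x, fderiv ℝ (fun y => S y + θ * (χ y * h n y)) x =
      fderiv ℝ S x + θ • (χ x • fderiv ℝ (h n) x + h n x • fderiv ℝ χ x) := fun x =>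
    ((hS.differentiable one_ne_zero x).hasFDerivAt.add
      (((hχ.differentiable one_ne_zero x).hasFDerivAt.mul
        ((hh n).differentiable one_ne_zero x).hasFDerivAt).const_mul θ)).fderiv
  have hcrit : ∀ x, x ∈ K ∨ ‖fderiv ℝ S x‖ ≥ 3 → fderiv ℝ χ x = 0 := by
    rintro x (hx | hx)
    · refine IsLocalMax.fderiv_eq_zero (Eventually.of_forall fun y => ?_)
      rw [hχ1 x hx]; exact (hχ01 y).2
    · refine IsLocalMin.fderiv_eq_zero (Eventually.of_forall fun y => ?_)
      rw [hχ0 x (not_lt.2 hx)]; exact (hχ01 y).1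
  refine ⟨fun y => S y + θ * (χ y * h n y), hS.add (contDiff_const.mul (hχ.mul (hh n))),
    fun x => ?_, fun x => ?_, fun x hx => ?_⟩
  · rw [hd]
    by_cases hx : ‖fderiv ℝ S x‖ < 3
    · calc _ ≤ ‖fderiv ℝ S x‖ + ‖θ • (χ x • fderiv ℝ (h n) x + h n x • fderiv ℝ χ x)‖ :=
            norm_add_le _ _
        _ ≤ 3 + (1 * 1 + 1) := by
            rw [norm_smul, Real.norm_eq_abs, hθ, one_mul]
            refine add_le_add hx.le ((norm_add_le _ _).trans (add_le_add ?_ ?_))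
            · rw [norm_smul, Real.norm_of_nonneg (hχ01 x).1]
              exact mul_le_mul (hχ01 x).2 (hh1 n x) (norm_nonneg _) zero_le_one
            · rw [norm_smul]; exact hhD x
        _ = 5 := by norm_num
    · rw [hcrit x (Or.inr (not_lt.1 hx)), hχ0 x hx]
      simpa using hS5 x
  · rw [add_sub_cancel_left, abs_mul, hθ, one_mul, abs_mul, abs_of_nonneg (hχ01 x).1]
    exact (mul_le_of_le_one_left (abs_nonneg _) (hχ01 x).2).trans (hhm x)
  · rw [hd, hcrit x (Or.inl hx), hχ1 x hx, one_smul, smul_zero, add_zero, add_sub_cancel_left,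
      ← smul_sub, norm_smul, Real.norm_eq_abs, hθ, one_mul, ← dist_eq_norm, dist_comm]
    exact (hnω x hx).le

/-- A stage of the construction of a non-differentiable Lipschitz function: a `C¹` function `S`
with a budget `m` for later modifications and a scale `r` at which these are invisible. -/
structure IsStage (K : Set E) (ω : E → E →L[ℝ] ℝ) (v : E) (j : ℕ) (S : E → ℝ) (m r : ℝ) :
    Prop where
  contDiff : ContDiff ℝ 1 S
  norm_fderiv_le : ∀ x, ‖fderiv ℝ S x‖ ≤ 5
  norm_sub_le : ∀ x ∈ K, ‖fderiv ℝ S x - ((1 - (-1) ^ j) / 2 : ℝ) • ω x‖ ≤ 1 - (1 / 2) ^ j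
  budget_pos : 0 < m
  scale_pos : 0 < r
  scale_lt : r < 1 / (j + 1)
  budget_le : m ≤ r * (1 / (j + 1))
  taylor : ∀ x ∈ K, |S (x + r • v) - S x - r * fderiv ℝ S x v| ≤ r * (1 / (j + 1))

lemma exists_stages {K : Set E} (hK : IsCompact K) {h : ℕ → E → ℝ} {ω : E → E →L[ℝ] ℝ}
    (hh : ∀ n, ContDiff ℝ 1 (h n)) (hh0 : ∀ n x, |h n x| ≤ 1 / (n + 1))
    (hh1 : ∀ n x, ‖fderiv ℝ (h n) x‖ ≤ 1)
    (hω : TendstoUniformlyOn (fun n x => fderiv ℝ (h n) x) ω atTop K) (v : E) :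
    ∃ (S : ℕ → E → ℝ) (m r : ℕ → ℝ), (∀ j, IsStage K ω v j (S j) (m j) (r j)) ∧
      (∀ j x, |S (j + 1) x - S j x| ≤ m j / 2) ∧ (∀ j, m (j + 1) ≤ m j / 2) ∧
      ∀ j, ∀ x ∈ K, ‖fderiv ℝ (S (j + 1)) x - fderiv ℝ (S j) x - ((-1) ^ j : ℝ) • ω x‖ ≤
        (1 / 2) ^ (j + 1) := by
  have hω1 : ∀ x ∈ K, ‖ω x‖ ≤ 1 := fun x hx =>
    le_of_tendsto (hω.tendsto_at hx).norm (Eventually.of_forall fun n => hh1 n x)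
  let T : ℕ → Type _ := fun j => {p : (E → ℝ) × ℝ × ℝ // IsStage K ω v j p.1 p.2.1 p.2.2}
  have hscale : ∀ (j : ℕ) (S : E → ℝ) (b : ℝ), 0 < b → ContDiff ℝ 1 S →
      (∀ x, ‖fderiv ℝ S x‖ ≤ 5) →
      (∀ x ∈ K, ‖fderiv ℝ S x - ((1 - (-1) ^ j) / 2 : ℝ) • ω x‖ ≤ 1 - (1 / 2) ^ j) →
      ∃ m r, IsStage K ω v j S m r ∧ m ≤ b := by
    intro j S b hb h1 h2 h3
    obtain ⟨r, hr0, hr, hT⟩ := exists_uniform_taylor h1 hK v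
      (show (0 : ℝ) < 1 / (j + 1) by positivity)
    exact ⟨min b (r * (1 / (j + 1))), r, ⟨h1, h2, h3, lt_min hb (by positivity), hr0, hr,
      min_le_right _ _, hT⟩, min_le_left _ _⟩
  have h0 : Nonempty (T 0) := by
    obtain ⟨m, r, hs, -⟩ := hscale 0 (fun _ => 0) 1 one_pos contDiff_const (by simp) (by simp)
    exact ⟨⟨(_, m, r), hs⟩⟩
  have hstep : ∀ (j : ℕ) (p : T j), ∃ q : T (j + 1),
      (∀ x, |q.1.1 x - p.1.1 x| ≤ p.1.2.1 / 2) ∧ q.1.2.1 ≤ p.1.2.1 / 2 ∧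
      ∀ x ∈ K, ‖fderiv ℝ q.1.1 x - fderiv ℝ p.1.1 x - ((-1) ^ j : ℝ) • ω x‖ ≤
        (1 / 2) ^ (j + 1) := by
    rintro j ⟨⟨S, m, r⟩, hS⟩
    dsimp only at hS ⊢
    have hm : 0 < m / 2 := half_pos hS.budget_pos
    have hpow : (0 : ℝ) < (1 / 2) ^ j := by positivity
    have hS2 : ∀ x ∈ K, ‖fderiv ℝ S x‖ ≤ 2 := by
      intro x hx
      have h1 : ‖((1 - (-1) ^ j) / 2 : ℝ) • ω x‖ ≤ 1 := by
        rcases neg_one_pow_eq_or ℝ j with hj | hj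
        · rw [hj]; simp
        · rw [hj]; norm_num; exact hω1 x hx
      have h2 := norm_sub_norm_le (fderiv ℝ S x) (((1 - (-1) ^ j) / 2 : ℝ) • ω x)
      linarith [hS.norm_sub_le x hx]
    obtain ⟨S', h1, h2, h3, h4⟩ := exists_alternate hK hh hh0 hh1 hω hS.contDiff
      hS.norm_fderiv_le hS2 (θ := (-1) ^ j) (η := (1 / 2) ^ (j + 1)) (by simp) (by positivity) hm
    obtain ⟨m', r', hS', hm'⟩ := hscale (j + 1) S' (m / 2) hm h1 h2 fun x hx => by
      have h5 : fderiv ℝ S' x - ((1 - (-1) ^ (j + 1)) / 2 : ℝ) • ω x =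
          (fderiv ℝ S' x - fderiv ℝ S x - ((-1) ^ j : ℝ) • ω x) +
          (fderiv ℝ S x - ((1 - (-1) ^ j) / 2 : ℝ) • ω x) := by
        rw [pow_succ]; module
      rw [h5]
      refine (norm_add_le _ _).trans ?_
      have := h4 x hx
      have := hS.norm_sub_le x hx
      rw [pow_succ] at *
      linarith
    exact ⟨⟨(S', m', r'), hS'⟩, h3, hm', h4⟩
  choose next h1 h2 h3 using hstep
  let F : ∀ j, T j := fun j => Nat.rec h0.some next j
  exact ⟨fun j => (F j).1.1, fun j => (F j).1.2.1, fun j => (F j).1.2.2, fun j => (F j).2,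
    fun j => h1 j (F j), fun j => h2 j (F j), fun j => h3 j (F j)⟩

theorem exists_lipschitz_not_differentiableAt {K : Set E} (hK : IsCompact K) {h : ℕ → E → ℝ}
    {ω : E → E →L[ℝ] ℝ} (hh : ∀ n, ContDiff ℝ 1 (h n)) (hh0 : ∀ n x, |h n x| ≤ 1 / (n + 1))
    (hh1 : ∀ n x, ‖fderiv ℝ (h n) x‖ ≤ 1)
    (hω : TendstoUniformlyOn (fun n x => fderiv ℝ (h n) x) ω atTop K) {v : E}
    (hv : ∀ x ∈ K, ω x v ≠ 0) :
    ∃ f : E → ℝ, LipschitzWith 5 f ∧ ∀ x ∈ K, ¬ DifferentiableAt ℝ f x := by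
  obtain ⟨S, m, r, hS, hSS, hm, hd⟩ := exists_stages hK hh hh0 hh1 hω v
  have hle : ∀ j i x, |S (j + i) x - S j x| ≤ m j - m (j + i) := by
    intro j i x
    induction i with
    | zero => simp
    | succ i ih =>
      have h1 := abs_sub_le (S (j + (i + 1)) x) (S (j + i) x) (S j x)
      have h2 := hSS (j + i) x
      have h3 := hm (j + i)
      rw [← add_assoc] at h1 ⊢
      linarith
  have hle' : ∀ j k x, j ≤ k → |S k x - S j x| ≤ m j := by
    intro j k x hjk
    obtain ⟨i, rfl⟩ := Nat.exists_eq_add_of_le hjk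
    linarith [hle j i x, (hS (j + i)).budget_pos]
  have hr0 : Tendsto r atTop (𝓝 0) := squeeze_zero (fun j => (hS j).scale_pos.le)
    (fun j => (hS j).scale_lt.le) tendsto_one_div_add_atTop_nhds_zero_nat
  have hm0 : Tendsto m atTop (𝓝 0) := by
    refine squeeze_zero (fun j => (hS j).budget_pos.le) (fun j => ?_) hr0
    refine (hS j).budget_le.trans (mul_le_of_le_one_right (hS j).scale_pos.le ?_)
    exact div_le_one_of_le₀ (by linarith [Nat.cast_nonneg (α := ℝ) j]) (by positivity)
  have hcau : ∀ x, CauchySeq fun j => S j x := fun x =>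
    cauchySeq_of_le_tendsto_0' m (fun j k hjk => by
      rw [dist_comm, Real.dist_eq]; exact hle' j k x hjk) hm0
  choose f hf using fun x => cauchySeq_tendsto_of_complete (hcau x)
  have hfS : ∀ j x, |f x - S j x| ≤ m j := fun j x =>
    le_of_tendsto ((hf x).sub_const _).abs
      (eventually_atTop.2 ⟨j, fun k hk => hle' j k x hk⟩)
  have hlip : ∀ j, LipschitzWith 5 (S j) := fun j =>
    lipschitzWith_of_nnnorm_fderiv_le (𝕜 := ℝ) ((hS j).contDiff.differentiable one_ne_zero)
      fun x => by exact_mod_cast (hS j).norm_fderiv_le x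
  refine ⟨f, LipschitzWith.of_dist_le_mul fun x y => ?_, fun x hx hdiff => ?_⟩
  · exact le_of_tendsto ((hf x).dist (hf y))
      (Eventually.of_forall fun j => (hlip j).dist_le_mul x y)
  have hline : HasDerivAt (fun t : ℝ => f (x + t • v)) (fderiv ℝ f x v) 0 := by
    have h1 : HasDerivAt (fun t : ℝ => x + t • v) v 0 := by
      simpa using ((hasDerivAt_id (0 : ℝ)).smul_const v).const_add x
    refine HasFDerivAt.comp_hasDerivAt (f := fun t : ℝ => x + t • v) (l := f) 0 ?_ h1
    simpa using hdiff.hasFDerivAt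
  have hslope : Tendsto (fun j => (r j)⁻¹ * (f (x + r j • v) - f x)) atTop
      (𝓝 (fderiv ℝ f x v)) := by
    have := hline.tendsto_slope_zero.comp (tendsto_nhdsWithin_iff.2
      ⟨hr0, Eventually.of_forall fun j => (hS j).scale_pos.ne'⟩)
    simpa [Function.comp_def] using this
  have hclose : ∀ j : ℕ, |(r j)⁻¹ * (f (x + r j • v) - f x) - fderiv ℝ (S j) x v| ≤
      3 * (1 / ((j : ℝ) + 1)) := by
    intro j
    have hr := (hS j).scale_pos
    have e1 : (r j)⁻¹ * (f (x + r j • v) - f x) - fderiv ℝ (S j) x v =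
        (r j)⁻¹ * ((f (x + r j • v) - S j (x + r j • v)) - (f x - S j x) +
          (S j (x + r j • v) - S j x - r j * fderiv ℝ (S j) x v)) := by
      field_simp
      ring
    rw [e1, abs_mul, abs_of_pos (inv_pos.2 hr), inv_mul_le_iff₀ hr]
    have h1 := abs_le.1 (hfS j (x + r j • v))
    have h2 := abs_le.1 (hfS j x)
    have h3 := abs_le.1 ((hS j).taylor x hx)
    have h4 := (hS j).budget_le
    rw [abs_le]
    constructor <;> linarith
  have hgrad : Tendsto (fun j => fderiv ℝ (S j) x v) atTop (𝓝 (fderiv ℝ f x v)) := by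
    have h1 : Tendsto (fun j : ℕ => 3 * (1 / ((j : ℝ) + 1))) atTop (𝓝 0) := by
      simpa using tendsto_one_div_add_atTop_nhds_zero_nat.const_mul (3 : ℝ)
    have h2 := squeeze_zero_norm (fun j => (Real.norm_eq_abs _).trans_le (hclose j)) h1
    simpa using hslope.sub h2
  have hdif : Tendsto (fun j => fderiv ℝ (S (j + 1)) x v - fderiv ℝ (S j) x v) atTop (𝓝 0) := by
    simpa using (hgrad.comp (tendsto_add_atTop_nat 1)).sub hgrad
  have hlow : ∀ j : ℕ, |ω x v| ≤
      |fderiv ℝ (S (j + 1)) x v - fderiv ℝ (S j) x v| + (1 / 2) ^ (j + 1) * ‖v‖ := by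
    intro j
    have h1 := ((fderiv ℝ (S (j + 1)) x - fderiv ℝ (S j) x - ((-1) ^ j : ℝ) • ω x).le_opNorm
      v).trans (mul_le_mul_of_nonneg_right (hd j x hx) (norm_nonneg v))
    simp only [sub_apply, smul_apply, smul_eq_mul, Real.norm_eq_abs] at h1
    have h2 : |(-1) ^ j * ω x v| = |ω x v| := by simp [abs_mul]
    have h3 := abs_sub_abs_le_abs_sub ((-1) ^ j * ω x v)
      (fderiv ℝ (S (j + 1)) x v - fderiv ℝ (S j) x v)
    rw [abs_sub_comm ((-1) ^ j * ω x v), h2] at h3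
    linarith
  have hzero : |ω x v| ≤ |(0 : ℝ)| + 0 * ‖v‖ := by
    refine ge_of_tendsto (hdif.abs.add (Tendsto.mul_const ‖v‖ ?_)) (Eventually.of_forall hlow)
    exact (tendsto_pow_atTop_nhds_zero_of_lt_one (by norm_num) (by norm_num)).comp
      (tendsto_add_atTop_nat 1)
  simp only [abs_zero, zero_mul, add_zero] at hzero
  exact hv x hx (abs_nonpos_iff.1 hzero)

end Nondifferentiable

theorem exists_derivBound_of_ae_differentiableAt {E : Type*} [NormedAddCommGroup E]
    [InnerProductSpace ℝ E] [FiniteDimensional ℝ E] [MeasurableSpace E] [BorelSpace E]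
    {ν : Measure E} [IsFiniteMeasure ν]
    (hν : ∀ f : E → ℝ, (∃ K, LipschitzWith K f) → ∀ᵐ x ∂ν, DifferentiableAt ℝ f x) (v : E)
    {ε : ℝ} (hε : 0 < ε) : ∃ C, 0 ≤ C ∧ DerivBound ν v C ε := by
  by_contra! H
  obtain ⟨K, h, ω, hK, hKpos, hh, hω, hv⟩ := exists_tendstoUniformlyOn_fderiv hε H
  obtain ⟨f, hf, hfK⟩ := exists_lipschitz_not_differentiableAt hK (fun n => (hh n).contDiff)
    (fun n => (hh n).abs_le) (fun n => (hh n).norm_fderiv_le) hω fun x hx => (hv x hx).ne'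
  exact hKpos.ne' (measure_mono_null hfK (hν f ⟨5, hf⟩))

/-- **The Rademacher theorem characterizes absolutely continuous measures.**
If `μ` is a finite positive Radon measure on `ℝ^d` such that every Lipschitz function
`f : ℝ^d → ℝ` is differentiable `μ`-almost everywhere, then `μ ≪ ℒ^d`. -/
theorem statement8 {d : ℕ}
    (μ : Measure (EuclideanSpace ℝ (Fin d))) [IsFiniteMeasure μ]
    (hdiff : ∀ f : EuclideanSpace ℝ (Fin d) → ℝ, (∃ K, LipschitzWith K f) →
      ∀ᵐ x ∂μ, DifferentiableAt ℝ f x) :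
    μ ≪ volume := by
  refine Measure.AbsolutelyContinuous.mk fun s hs hs0 => ?_
  by_contra hne
  obtain ⟨K, hKs, hKc, hKpos⟩ := hs.exists_lt_isCompact (pos_iff_ne_zero.2 hne)
  have h := measure_univ_eq_zero_of_derivBound (ν := μ.restrict K) hKc
    (measure_mono_null hKs hs0) (by
      rw [Measure.restrict_apply hKc.measurableSet.compl, Set.compl_inter_self, measure_empty])
    fun v ε hε => exists_derivBound_of_ae_differentiableAt
      (fun f hf => ae_restrict_of_ae (hdiff f hf)) v hε
  rw [Measure.restrict_apply_univ] at h
  exact hKpos.ne' h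
end

section
/- Let {f_j} ⊂ L¹(ℝ^d) be a sequence of functions vanishing a.e. outside the unit ball B₁ such that: (a) f_j → 0 in the sense of distributions on B₁, i.e. ∫ f_j φ dx → 0 for every φ ∈ C_c^∞(B₁); (b) the negative parts f_j⁻ := max{0, −f_j} tend to zero in measure, i.e. ℒ^d({f_j⁻ > λ}) → 0 as j → ∞ for every λ > 0; and (c) the sequence {f_j⁻} is equi-integrable, i.e. sup_j ∫_E f_j⁻ dx → 0 as ℒ^d(E) → 0. Then f_j → 0 in L¹_loc(B₁), i.e. ∫_K |f_j| dx → 0 for every compact K ⊂ B₁. -/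
open MeasureTheory Metric Filter Topology

/-- Vitali convergence for nonnegative functions: convergence in measure to zero together with
equi-integrability and a common support of finite measure forces the integrals to tend to zero. -/
theorem tendsto_integral_zero_of_equiIntegrable {α : Type*} [MeasurableSpace α] {μ : Measure α}
    {g : ℕ → α → ℝ} {B : Set α} (hB : MeasurableSet B) (hBfin : μ B ≠ ⊤)
    (hg : ∀ j, Integrable (g j) μ) (hg0 : ∀ j x, 0 ≤ g j x)
    (hsupp : ∀ j, ∀ᵐ x ∂μ, x ∉ B → g j x = 0)
    (hmeas : ∀ c : ℝ, 0 < c → Tendsto (fun j => μ {x | c < g j x}) atTop (𝓝 0))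
    (hequi : ∀ ε : ℝ, 0 < ε → ∃ δ : ℝ, 0 < δ ∧ ∀ A : Set α, MeasurableSet A →
      μ A < ENNReal.ofReal δ → ∀ j, ∫ x in A, g j x ∂μ ≤ ε) :
    Tendsto (fun j => ∫ x, g j x ∂μ) atTop (𝓝 0) := by
  rw [Metric.tendsto_atTop']
  intro ε hε
  have hM : 0 ≤ μ.real B := measureReal_nonneg
  set c : ℝ := ε / (4 * (μ.real B + 1)) with hc
  have hc0 : 0 < c := by positivity
  have hcM : c * μ.real B ≤ ε / 4 := by
    rw [hc, div_mul_eq_mul_div, div_le_div_iff₀ (by positivity) (by norm_num)]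
    nlinarith
  obtain ⟨δ, hδ, hA⟩ := hequi (ε / 2) (by positivity)
  have hev := (hmeas c hc0).eventually (gt_mem_nhds (ENNReal.ofReal_pos.2 hδ))
  obtain ⟨N, hN⟩ := eventually_atTop.1 hev
  refine ⟨N, fun j hj => ?_⟩
  set A := toMeasurable μ {x | c < g j x} with hAdef
  have hAm : MeasurableSet A := measurableSet_toMeasurable _ _
  have hsmall : ∫ x in A, g j x ∂μ ≤ ε / 2 :=
    hA A hAm (by rw [hAdef, measure_toMeasurable]; exact hN j hj.le) j
  have hint : Integrable (B.indicator fun _ => c) μ :=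
    (integrable_indicator_iff hB).2 (integrableOn_const hBfin)
  have hflat : ∫ x in Aᶜ, g j x ∂μ ≤ c * μ.real B := by
    calc ∫ x in Aᶜ, g j x ∂μ ≤ ∫ x in Aᶜ, B.indicator (fun _ => c) x ∂μ := by
          refine setIntegral_mono_on_ae (hg j).integrableOn hint.integrableOn hAm.compl ?_
          filter_upwards [hsupp j] with x hx hxA
          by_cases hxB : x ∈ B
          · rw [Set.indicator_of_mem hxB]
            by_contra! h
            exact hxA (subset_toMeasurable μ _ h)
          · rw [Set.indicator_of_notMem hxB, hx hxB]
      _ ≤ ∫ x, B.indicator (fun _ => c) x ∂μ :=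
          setIntegral_le_integral hint
            (Eventually.of_forall fun x => Set.indicator_nonneg (fun _ _ => hc0.le) x)
      _ = c * μ.real B := by
          rw [integral_indicator hB, setIntegral_const, smul_eq_mul, mul_comm]
  have hsplit := integral_add_compl hAm (hg j)
  rw [Real.dist_eq, sub_zero, abs_of_nonneg (integral_nonneg (hg0 j))]
  linarith

/-- A smooth cutoff between a compact subset of a ball and the ball itself. -/
theorem exists_contDiff_cutoff_ball {E : Type*} [NormedAddCommGroup E] [InnerProductSpace ℝ E]
    [FiniteDimensional ℝ E] {K : Set E} {x : E} {r : ℝ} (hr : 0 < r) (hK : IsClosed K)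
    (hKr : K ⊆ ball x r) :
    ∃ φ : E → ℝ, ContDiff ℝ (⊤ : ℕ∞) φ ∧ HasCompactSupport φ ∧ tsupport φ ⊆ ball x r ∧
      (∀ y, 0 ≤ φ y) ∧ (∀ y, φ y ≤ 1) ∧ ∀ y ∈ K, φ y = 1 := by
  obtain ⟨s, hsr, hKs⟩ := exists_pos_lt_subset_ball hr hK hKr
  let φ : ContDiffBump x := ⟨s, (s + r) / 2, hsr.1, by linarith [hsr.2]⟩
  refine ⟨φ, φ.contDiff, φ.hasCompactSupport, ?_, fun _ => φ.nonneg, fun _ => φ.le_one,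
    fun y hy => φ.one_of_mem_closedBall (ball_subset_closedBall (hKs hy))⟩
  rw [φ.tsupport_eq]
  exact closedBall_subset_ball (show (s + r) / 2 < r by linarith [hsr.2])

/-- **A Vitali-type convergence lemma.**
Let `f_j ∈ L¹(ℝ^d)` vanish a.e. outside the unit ball `B₁` and satisfy:
(a) `f_j → 0` in `𝒟'(B₁)`; (b) the negative parts `f_j⁻` tend to `0` in measure;
(c) the negative parts `f_j⁻` are equi-integrable.  Then `f_j → 0` in `L¹_loc(B₁)`. -/
theorem statement13 {d : ℕ} (f : ℕ → EuclideanSpace ℝ (Fin d) → ℝ)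
    (hint : ∀ j, Integrable (f j) volume)
    (hsupp : ∀ j, ∀ᵐ x ∂volume, x ∉ ball (0 : EuclideanSpace ℝ (Fin d)) 1 → f j x = 0)
    (ha : ∀ φ : EuclideanSpace ℝ (Fin d) → ℝ,
      ContDiff ℝ (⊤ : ℕ∞) φ → HasCompactSupport φ →
      tsupport φ ⊆ ball (0 : EuclideanSpace ℝ (Fin d)) 1 →
        Tendsto (fun j => ∫ x, f j x * φ x) atTop (𝓝 0))
    (hb : ∀ lam : ℝ, 0 < lam →
        Tendsto (fun j => volume {x | lam < max 0 (-(f j x))}) atTop (𝓝 0))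
    (hc : ∀ ε : ℝ, 0 < ε → ∃ δ : ℝ, 0 < δ ∧
      ∀ A : Set (EuclideanSpace ℝ (Fin d)), MeasurableSet A →
        volume A < ENNReal.ofReal δ → ∀ j, ∫ x in A, max 0 (-(f j x)) ∂volume ≤ ε) :
    ∀ K : Set (EuclideanSpace ℝ (Fin d)), IsCompact K →
      K ⊆ ball (0 : EuclideanSpace ℝ (Fin d)) 1 →
        Tendsto (fun j => ∫ x in K, |f j x| ∂volume) atTop (𝓝 0) := by
  intro K hK hKball
  have hneg : ∀ j, Integrable (fun x => max 0 (-(f j x))) volume := fun j => by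
    simpa [max_comm] using (hint j).neg.pos_part
  have hneg_lim : Tendsto (fun j => ∫ x, max 0 (-(f j x))) atTop (𝓝 0) := by
    refine tendsto_integral_zero_of_equiIntegrable
      (measurableSet_ball (x := 0) (ε := 1))
      measure_ball_lt_top.ne hneg (fun j x => le_max_left _ _) (fun j => ?_) hb hc
    filter_upwards [hsupp j] with x hx hxB
    simp [hx hxB]
  obtain ⟨φ, hφ, hφc, hφs, hφ0, hφ1, hφK⟩ :=
    exists_contDiff_cutoff_ball one_pos hK.isClosed hKball
  have hmul : ∀ g : EuclideanSpace ℝ (Fin d) → ℝ, Integrable g volume →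
      Integrable (fun x => g x * φ x) volume := fun g hg =>
    hg.mul_bdd (c := 1) hφ.continuous.aestronglyMeasurable
      (Eventually.of_forall fun x => by
        rw [Real.norm_eq_abs, abs_of_nonneg (hφ0 x)]
        exact hφ1 x)
  have hlim := (ha φ hφ hφc hφs).add (hneg_lim.const_mul 2)
  rw [mul_zero, add_zero] at hlim
  refine squeeze_zero (fun j => integral_nonneg fun x => abs_nonneg _) (fun j => ?_) hlim
  calc ∫ x in K, |f j x| = ∫ x in K, |f j x| * φ x :=
        setIntegral_congr_fun hK.measurableSet fun x hx => by simp [hφK x hx]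
    _ ≤ ∫ x, |f j x| * φ x :=
        setIntegral_le_integral (hmul _ (hint j).abs)
          (Eventually.of_forall fun x => mul_nonneg (abs_nonneg _) (hφ0 x))
    _ ≤ ∫ x, (f j x * φ x + 2 * max 0 (-(f j x))) := by
        refine integral_mono (hmul _ (hint j).abs) ((hmul _ (hint j)).add ((hneg j).const_mul 2))
          fun x => ?_
        have h0 := hφ0 x
        have h1 := hφ1 x
        dsimp only
        rcases le_total 0 (f j x) with h | h
        · rw [abs_of_nonneg h, max_eq_left (by linarith)]
          linarith
        · rw [abs_of_nonpos h, max_eq_right (by linarith)]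
          nlinarith
    _ = (∫ x, f j x * φ x) + 2 * ∫ x, max 0 (-(f j x)) := by
        rw [integral_add (hmul _ (hint j)) ((hneg j).const_mul 2), integral_const_mul]
end

section
/- (Kernel of the Saint-Venant symbol.) Let d ≥ 1 and let ξ ∈ ℝ^d ∖ {0}. For a symmetric matrix M ∈ ℝ^{d×d}_sym one has (Mξ)⊗ξ + ξ⊗(Mξ) − (tr M) ξ⊗ξ − |ξ|² M = 0 if and only if M = a⊗ξ + ξ⊗a for some a ∈ ℝ^d. -/
/-- **Kernel of the Saint-Venant symbol.**
For `ξ ∈ ℝ^d ∖ {0}` and a symmetric matrix `M`, one has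
`(Mξ)⊗ξ + ξ⊗(Mξ) − (tr M) ξ⊗ξ − |ξ|² M = 0` if and only if
`M = a⊗ξ + ξ⊗a` for some `a ∈ ℝ^d`. -/
theorem statement14 {d : ℕ} (hd : 1 ≤ d) (ξ : Fin d → ℝ) (hξ : ξ ≠ 0)
    (M : Matrix (Fin d) (Fin d) ℝ) (hM : M.IsSymm) :
    Matrix.vecMulVec (M.mulVec ξ) ξ + Matrix.vecMulVec ξ (M.mulVec ξ)
        - Matrix.trace M • Matrix.vecMulVec ξ ξ - (∑ i, ξ i ^ 2) • M = 0
      ↔ ∃ a : Fin d → ℝ, M = Matrix.vecMulVec a ξ + Matrix.vecMulVec ξ a := by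
  have hs : ∑ i, ξ i ^ 2 = ξ ⬝ᵥ ξ := by simp only [dotProduct, sq]
  rw [hs]
  have hs0 : ξ ⬝ᵥ ξ ≠ 0 := mt dotProduct_self_eq_zero.mp hξ
  constructor
  · intro h
    refine ⟨(ξ ⬝ᵥ ξ)⁻¹ • (M.mulVec ξ - (M.trace / 2) • ξ), ?_⟩
    ext i j
    have hij := congrFun₂ h i j
    simp only [Matrix.add_apply, Matrix.sub_apply, Matrix.smul_apply, Matrix.vecMulVec_apply,
      Matrix.zero_apply, Pi.smul_apply, Pi.sub_apply, smul_eq_mul] at hij ⊢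
    field_simp
    linarith
  · rintro ⟨a, rfl⟩
    ext i j
    simp only [Matrix.add_mulVec, Matrix.vecMulVec_mulVec, Matrix.trace_add,
      Matrix.trace_vecMulVec, dotProduct_comm ξ a, Matrix.add_apply, Matrix.sub_apply,
      Matrix.smul_apply, Matrix.vecMulVec_apply, Matrix.zero_apply, Pi.add_apply, Pi.smul_apply,
      MulOpposite.smul_eq_mul_unop, MulOpposite.unop_op, smul_eq_mul]
    ring
end
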